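/- arXiv:1908.04448 — 2 statements merged into one kernel-verified Lean document; each statement's English description precedes it below -/
import Mathlib

section
/- Fix n ≥ 1, k ∈ ℤ, and a field F. Let A = F[c_1,...,c_n,x_1,x_2,...]/(h_n, h_{n+1}, ...) with grading |c_i| = |x_i| = 2i, where h_i = k·c_i + Σ_{j=1}^{i} (-1)^j s_j(x_1,...,x_j)·c_{i-j} (c_0 = 1, c_m = 0 for m > n). Then the images of c_1, ..., c_n form a regular sequence in A, and A/(c_1,...,c_n) ≅ F[x_1,x_2,...]/(s_n, s_{n+1}, ...). -/
open MvPolynomial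

/-- The `i`-th Newton polynomial `s_i ∈ R[x_1, x_2, …]`, defined by the recursion
`s_i = x_1 s_{i-1} - x_2 s_{i-2} + ⋯ + (-1)^{i-1} i x_i` (and `s_0 = 0`). -/
noncomputable def newtonPoly (R : Type) [CommRing R] : ℕ → MvPolynomial ℕ+ R
  | 0 => 0
  | (i + 1) =>
      (∑ j ∈ Finset.range i,
        (-1 : MvPolynomial ℕ+ R) ^ j * (X (⟨j + 1, j.succ_pos⟩ : ℕ+) : MvPolynomial ℕ+ R) *
          newtonPoly R (i - j))
      + (-1) ^ i * ((i : MvPolynomial ℕ+ R) + 1) * (X (⟨i + 1, i.succ_pos⟩ : ℕ+) : MvPolynomial ℕ+ R)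
  decreasing_by omega

/-- The generator `c_m` of `R[c_1, …, c_n, x_1, x_2, …]`, with the conventions `c_0 = 1`
and `c_m = 0` for `m > n`. -/
noncomputable def cvar (R : Type) [CommRing R] (n m : ℕ) : MvPolynomial (Fin n ⊕ ℕ+) R :=
  if h0 : m = 0 then 1
  else if h : m ≤ n then X (Sum.inl ⟨m - 1, by omega⟩) else 0

/-- The relation `h_i = k c_i + ∑_{j=1}^i (-1)^j s_j(x_1, …, x_j) c_{i-j}`. -/
noncomputable def hRel (R : Type) [CommRing R] (n : ℕ) (k : ℤ) (i : ℕ) :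
    MvPolynomial (Fin n ⊕ ℕ+) R :=
  C (k : R) * cvar R n i +
    ∑ j ∈ Finset.range i,
      (-1 : MvPolynomial (Fin n ⊕ ℕ+) R) ^ (j + 1) *
        rename Sum.inr (newtonPoly R (j + 1)) * cvar R n (i - (j + 1))



theorem vars_weaklyRegular (n : ℕ) (F : Type) [Field F] :
    RingTheory.Sequence.IsWeaklyRegular (MvPolynomial (Fin n) F)
      (List.ofFn (fun i : Fin n => (X i : MvPolynomial (Fin n) F))) := by
  constructor
  intro i hi
  have hi' : i < n := by simpa using hi
  have hset : ∀ x : MvPolynomial (Fin n) F,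
      x ∈ (Ideal.ofList ((List.ofFn (fun i : Fin n => (X i : MvPolynomial (Fin n) F))).take i) •
        (⊤ : Submodule (MvPolynomial (Fin n) F) (MvPolynomial (Fin n) F))) ↔
      x ∈ Ideal.span (X '' {j : Fin n | (j : ℕ) < i}) := by
    intro x
    have : {r | r ∈ (List.ofFn (fun i : Fin n => (X i : MvPolynomial (Fin n) F))).take i} =
        X '' {j : Fin n | (j : ℕ) < i} := by
      ext r
      simp only [Set.mem_ofPred_eq, List.mem_take_iff_getElem, List.getElem_ofFn, Set.mem_image]
      constructor
      · rintro ⟨j, hj, rfl⟩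
        have := hj
        simp at this
        exact ⟨⟨j, by omega⟩, by simp; omega, rfl⟩
      · rintro ⟨j, hj, rfl⟩
        exact ⟨j, by simpa using hj, rfl⟩
    rw [Ideal.ofList, this, smul_eq_mul, Ideal.mul_top]
  rw [isSMulRegular_iff_right_eq_zero_of_smul]
  intro x
  obtain ⟨x, rfl⟩ := Submodule.Quotient.mk_surjective _ x
  intro h
  rw [← Submodule.Quotient.mk_smul, Submodule.Quotient.mk_eq_zero, hset,
    mem_ideal_span_X_image] at h
  rw [Submodule.Quotient.mk_eq_zero, hset, mem_ideal_span_X_image]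
  intro m hm
  simp only [List.getElem_ofFn, smul_eq_mul] at h
  obtain ⟨j, hj, hne⟩ := h (Finsupp.single ⟨i, hi'⟩ 1 + m) (by
    rw [mem_support_iff, coeff_X_mul]; exact mem_support_iff.mp hm)
  refine ⟨j, hj, ?_⟩
  have hj' : (j : ℕ) < i := hj
  have : (⟨i, hi'⟩ : Fin n) ≠ j := by
    intro h; rw [← h] at hj'; simp at hj'
  simpa [Finsupp.single_apply, this] using hne

theorem weaklyRegular_of_retract {R A P : Type} [CommRing R] [CommRing A] [CommRing P]
    [Algebra R P] [Module.Flat R P] (ι : R →+* A) (φ : A →+* P) (ψ : P →+* A)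
    (h : ∀ a, ψ (φ a) = a) (hι : ∀ r, φ (ι r) = algebraMap R P r)
    (rs : List R) (hrs : RingTheory.Sequence.IsWeaklyRegular R rs) :
    RingTheory.Sequence.IsWeaklyRegular A (rs.map ι) := by
  letI : Algebra R A := ι.toAlgebra
  have h2 : ∀ r, ψ (algebraMap R P r) = ι r := fun r => by rw [← hι, h]
  let φ' : A →ₐ[R] P := { φ with commutes' := hι }
  let ψ' : P →ₐ[R] A := { ψ with commutes' := h2 }
  have : Module.Flat R A := Module.Flat.of_retract φ'.toLinearMap ψ'.toLinearMap
    (LinearMap.ext h)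
  exact hrs.of_flat

section flat
variable {R : Type} [CommRing R] {σ : Type}

/-- polynomials all of whose monomials have degree `< d` -/
noncomputable def ltDeg (R : Type) [CommRing R] (σ : Type) (d : ℕ) :
    Submodule R (MvPolynomial σ R) := restrictSupport R {e | e.degree < d}

theorem mem_ltDeg {d : ℕ} {q : MvPolynomial σ R} :
    q ∈ ltDeg R σ d ↔ ∀ e ∈ q.support, e.degree < d := by
  simp only [ltDeg, mem_restrictSupport_iff]
  rfl

theorem ltDeg_mono {d d' : ℕ} (h : d ≤ d') : ltDeg R σ d ≤ ltDeg R σ d' := by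
  intro q hq
  rw [mem_ltDeg] at *
  exact fun e he => (hq e he).trans_le h

theorem ltDeg_zero {q : MvPolynomial σ R} (h : q ∈ ltDeg R σ 0) : q = 0 := by
  rw [mem_ltDeg] at h
  rw [← support_eq_empty, Finset.eq_empty_iff_forall_notMem]
  intro e he
  simpa using h e he

theorem mul_mem_ltDeg {a b : ℕ} {q r : MvPolynomial σ R} (hq : q ∈ ltDeg R σ a)
    (hr : r ∈ ltDeg R σ (b + 1)) : q * r ∈ ltDeg R σ (a + b) := by
  classical
  rw [mem_ltDeg] at *
  intro e he
  obtain ⟨u, hu, v, hv, rfl⟩ := Finset.mem_add.mp (support_mul q r he)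
  have := hq u hu
  have := hr v hv
  rw [map_add]; omega

theorem monomial_mem_ltDeg (e : σ →₀ ℕ) (r : R) : monomial e r ∈ ltDeg R σ (e.degree + 1) := by
  classical
  rw [mem_ltDeg]
  intro u hu
  have := support_monomial_subset hu
  simp at this
  subst this
  omega

/-- `q` has leading monomial `e` w.r.t. degree. -/
def Lead (q : MvPolynomial σ R) (e : σ →₀ ℕ) : Prop := q - monomial e 1 ∈ ltDeg R σ e.degree

theorem Lead.mul {q r : MvPolynomial σ R} {e f : σ →₀ ℕ} (hq : Lead q e) (hr : Lead r f) :
    Lead (q * r) (e + f) := by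
  unfold Lead at *
  have hr' : r ∈ ltDeg R σ (f.degree + 1) := by
    have := add_mem (ltDeg_mono (Nat.le_succ _) hr) (monomial_mem_ltDeg f (1 : R))
    simpa using this
  have h1 := mul_mem_ltDeg hq hr'
  have h2 := mul_mem_ltDeg hr (monomial_mem_ltDeg e (1 : R))
  have : q * r - monomial (e + f) 1 = (q - monomial e 1) * r + (r - monomial f 1) * monomial e 1 := by
    have : (monomial (e + f) 1 : MvPolynomial σ R) = monomial e 1 * monomial f 1 := by
      rw [monomial_mul, one_mul]
    rw [this]; ring
  rw [this, map_add]
  exact add_mem h1 (by rw [add_comm e.degree]; exact h2)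

theorem Lead.one : Lead (1 : MvPolynomial σ R) 0 := by
  simp [Lead]

theorem Lead.pow {q : MvPolynomial σ R} {e : σ →₀ ℕ} (hq : Lead q e) (m : ℕ) :
    Lead (q ^ m) (m • e) := by
  induction m with
  | zero => simpa using Lead.one
  | succ m ih => rw [pow_succ, succ_nsmul]; exact ih.mul hq

theorem Lead.prod {ι : Type} (s : Finset ι) (q : ι → MvPolynomial σ R) (e : ι → σ →₀ ℕ)
    (h : ∀ i ∈ s, Lead (q i) (e i)) : Lead (∏ i ∈ s, q i) (∑ i ∈ s, e i) := by
  classical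
  induction s using Finset.induction_on with
  | empty => simpa using Lead.one
  | insert a s ha ih =>
    rw [Finset.prod_insert ha, Finset.sum_insert ha]
    exact (h a (by simp)).mul (ih fun i hi => h i (by simp [hi]))

variable [Fintype σ] (p : ℕ) (ℓ : σ → MvPolynomial σ R)

/-- The unitriangular endomorphism. -/
noncomputable def Phi : MvPolynomial σ R →ₗ[R] MvPolynomial σ R :=
  (basisMonomials σ R).constr R
    (fun e => ∏ m, ((X m ^ p - ℓ m) ^ (e m / p) * X m ^ (e m % p)))

theorem Phi_monomial (e : σ →₀ ℕ) :
    Phi p ℓ (monomial e 1) = ∏ m, ((X m ^ p - ℓ m) ^ (e m / p) * X m ^ (e m % p)) := by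
  have := (basisMonomials σ R).constr_basis R
    (fun e => ∏ m, ((X m ^ p - ℓ m) ^ (e m / p) * X m ^ (e m % p))) e
  rwa [coe_basisMonomials] at this

variable {p}

theorem Phi_mul (hp : 0 < p) (m : σ) (q : MvPolynomial σ R) :
    Phi p ℓ (X m ^ p * q) = (X m ^ p - ℓ m) * Phi p ℓ q := by
  classical
  induction q using MvPolynomial.induction_on' with
  | add a b ha hb => rw [mul_add, map_add, map_add, ha, hb, mul_add]
  | monomial e r =>
    have h1 : (monomial e r : MvPolynomial σ R) = r • monomial e 1 := by
      rw [smul_monomial, smul_eq_mul, mul_one]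
    rw [h1, mul_smul_comm, map_smul, map_smul, mul_smul_comm]
    congr 1
    rw [X_pow_eq_monomial, monomial_mul, one_mul, Phi_monomial, Phi_monomial,
      ← Finset.mul_prod_erase _ _ (Finset.mem_univ m),
      ← Finset.mul_prod_erase (s := Finset.univ) (f := fun m => (X m ^ p - ℓ m) ^ (e m / p) * X m ^ (e m % p)) (a := m) (Finset.mem_univ m)]
    rw [← mul_assoc]
    congr 1
    · simp only [Finsupp.add_apply, Finsupp.single_eq_same, Nat.add_mod_left,
        Nat.add_div_left _ hp, pow_succ, ← X_pow_eq_monomial]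
      ring
    · refine Finset.prod_congr rfl fun j hj => ?_
      have : m ≠ j := fun h => by simp [h] at hj
      simp [Finsupp.single_apply, this]

theorem Phi_lead (hℓ : ∀ m, ℓ m ∈ ltDeg R σ p) (e : σ →₀ ℕ) :
    Lead (Phi p ℓ (monomial e 1)) e := by
  classical
  rw [Phi_monomial]
  have : e = ∑ m, ((e m / p) • Finsupp.single m p + (e m % p) • Finsupp.single m 1) := by
    ext j
    simp only [Finsupp.coe_finsetSum, Finset.sum_apply, Finsupp.add_apply, Finsupp.smul_apply,
      Finsupp.single_apply, smul_eq_mul]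
    rw [Finset.sum_eq_single j]
    · simp [Nat.div_add_mod']
    · intro b _ hb; simp [hb]
    · simp
  conv => rhs; rw [this]
  refine Lead.prod _ _ _ fun m _ => Lead.mul (Lead.pow ?_ _) (Lead.pow ?_ _)
  · unfold Lead
    rw [X_pow_eq_monomial]
    simpa using hℓ m
  · simp [Lead, X]

theorem Phi_sub_mem (hℓ : ∀ m, ℓ m ∈ ltDeg R σ p) (d : ℕ) (q : MvPolynomial σ R)
    (hq : q ∈ ltDeg R σ (d + 1)) : Phi p ℓ q - q ∈ ltDeg R σ d := by
  rw [mem_ltDeg] at hq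
  conv in Phi p ℓ q - q => rw [q.as_sum]
  rw [map_sum, ← Finset.sum_sub_distrib]
  refine sum_mem fun e he => ?_
  have h1 : (monomial e (coeff e q) : MvPolynomial σ R) = coeff e q • monomial e 1 := by
    rw [smul_monomial, smul_eq_mul, mul_one]
  rw [h1, map_smul, ← smul_sub]
  exact Submodule.smul_mem _ _ (ltDeg_mono (by have := hq e he; omega) (Phi_lead ℓ hℓ e))

theorem exists_ltDeg (q : MvPolynomial σ R) : ∃ d, q ∈ ltDeg R σ d := by
  refine ⟨q.support.sup Finsupp.degree + 1, ?_⟩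
  rw [mem_ltDeg]
  intro e he
  exact Nat.lt_succ_of_le (Finset.le_sup (f := Finsupp.degree) he)

theorem Phi_bijective (hℓ : ∀ m, ℓ m ∈ ltDeg R σ p) : Function.Bijective (Phi p ℓ) := by
  constructor
  · rw [injective_iff_map_eq_zero]
    intro q hq
    obtain ⟨d, hd⟩ := exists_ltDeg q
    induction d with
    | zero => exact ltDeg_zero hd
    | succ d ih =>
      have := Phi_sub_mem ℓ hℓ d q hd
      rw [hq, zero_sub, neg_mem_iff] at this
      exact ih this
  · intro q
    obtain ⟨d, hd⟩ := exists_ltDeg q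
    induction d generalizing q with
    | zero => exact ⟨0, by rw [ltDeg_zero hd, map_zero]⟩
    | succ d ih =>
      obtain ⟨r, hr⟩ := ih _ (Phi_sub_mem ℓ hℓ d q hd)
      exact ⟨q - r, by rw [map_sub, hr]; abel⟩

/-- projection to reduced monomials -/
noncomputable def redProj (R : Type) [CommRing R] (σ : Type) (p : ℕ) :
    MvPolynomial σ R →ₗ[R] MvPolynomial σ R :=
  open Classical in
  (basisMonomials σ R).constr R (fun e => if ∀ m, e m < p then monomial e 1 else 0)

open Classical in
theorem redProj_monomial (e : σ →₀ ℕ) :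
    redProj R σ p (monomial e 1) = if ∀ m, e m < p then monomial e 1 else 0 := by
  have := (basisMonomials σ R).constr_basis R
    (fun e => if ∀ m, e m < p then (monomial e 1 : MvPolynomial σ R) else 0) e
  rw [coe_basisMonomials] at this
  rw [redProj]
  convert this

theorem redProj_mul (m : σ) (q : MvPolynomial σ R) : redProj R σ p (X m ^ p * q) = 0 := by
  classical
  induction q using MvPolynomial.induction_on' with
  | add a b ha hb => rw [mul_add, map_add, ha, hb, add_zero]
  | monomial e r =>
    have h1 : (monomial e r : MvPolynomial σ R) = r • monomial e 1 := by
      rw [smul_monomial, smul_eq_mul, mul_one]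
    rw [h1, mul_smul_comm, map_smul, X_pow_eq_monomial, monomial_mul, one_mul, redProj_monomial,
      if_neg, smul_zero]
    intro h
    have := h m
    simp at this

theorem Phi_redProj (hp : 0 < p) (q : MvPolynomial σ R) :
    Phi p ℓ (q - redProj R σ p q) ∈ Ideal.span (Set.range fun m => X m ^ p - ℓ m) := by
  classical
  induction q using MvPolynomial.induction_on' with
  | add a b ha hb =>
    have := add_mem ha hb
    rw [← map_add] at this
    convert this using 2
    rw [map_add]; ring
  | monomial e r =>
    have h1 : (monomial e r : MvPolynomial σ R) = r • monomial e 1 := by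
      rw [smul_monomial, smul_eq_mul, mul_one]
    rw [h1, map_smul, ← smul_sub, map_smul]
    refine Submodule.smul_of_tower_mem _ _ ?_
    rw [redProj_monomial]
    split_ifs with h
    · simp
    · push Not at h
      obtain ⟨m, hm⟩ := h
      have : (monomial e 1 : MvPolynomial σ R) = X m ^ p * monomial (e - Finsupp.single m p) 1 := by
        rw [X_pow_eq_monomial, monomial_mul, one_mul, add_tsub_cancel_of_le]
        simpa using hm
      rw [sub_zero, this, Phi_mul ℓ hp]
      exact Ideal.mul_mem_right _ _ (Ideal.subset_span ⟨m, rfl⟩)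

theorem flat_of_split {A : Type} [CommRing A] [Algebra R A] [Module.Flat R A] (I : Ideal A)
    (f g : A →ₗ[R] A) (hf : ∀ a ∈ I, f a = 0) (hg : ∀ a, g (f a) - a ∈ I) :
    Module.Flat R (A ⧸ I) := by
  let i : (A ⧸ I.restrictScalars R) →ₗ[R] A := (I.restrictScalars R).liftQ f hf
  let j : A →ₗ[R] (A ⧸ I.restrictScalars R) := (I.restrictScalars R).mkQ ∘ₗ g
  have : Module.Flat R (A ⧸ I.restrictScalars R) := by
    refine Module.Flat.of_retract i j ?_
    ext q
    exact (Submodule.Quotient.eq _).mpr (hg q)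
  exact Module.Flat.of_linearEquiv (Submodule.Quotient.restrictScalarsEquiv R I).symm

theorem flat_quotient (hp : 0 < p) (hℓ : ∀ m, ℓ m ∈ ltDeg R σ p) :
    Module.Flat R (MvPolynomial σ R ⧸ Ideal.span (Set.range fun m => X m ^ p - ℓ m)) := by
  let E := LinearEquiv.ofBijective (Phi p ℓ) (Phi_bijective ℓ hℓ)
  have hE : ∀ q, Phi p ℓ (E.symm q) = q := fun q => E.apply_symm_apply q
  have hE' : ∀ q, E.symm (Phi p ℓ q) = q := fun q => E.symm_apply_apply q
  refine flat_of_split _ (redProj R σ p ∘ₗ E.symm.toLinearMap) (Phi p ℓ) ?_ ?_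
  · intro a ha
    rw [LinearMap.comp_apply, LinearEquiv.coe_coe]
    induction ha using Submodule.span_induction with
    | zero => simp
    | add a b _ _ ha hb => rw [map_add, map_add, ha, hb, add_zero]
    | mem a ha =>
      obtain ⟨m, rfl⟩ := ha
      have h1 := Phi_mul ℓ hp m (E.symm 1)
      rw [hE, mul_one] at h1
      simp only
      rw [← h1, hE', redProj_mul]
    | smul a b hb _ =>
      clear * - hE hE' hb hp
      rw [smul_eq_mul]
      induction hb using Submodule.span_induction generalizing a with
      | zero => simp
      | add x y _ _ hx hy => rw [mul_add, map_add, map_add, hx, hy, add_zero]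
      | smul x y _ hy => rw [smul_eq_mul, ← mul_assoc]; exact hy _
      | mem x hx =>
        obtain ⟨m, rfl⟩ := hx
        have h1 := Phi_mul ℓ hp m (E.symm a)
        rw [hE] at h1
        simp only
        rw [mul_comm, ← h1, hE', redProj_mul]
  · intro a
    have := Phi_redProj ℓ hp (E.symm a)
    rw [map_sub, hE] at this
    rw [← neg_mem_iff, neg_sub]
    exact this
end flat
/-- The index `j + 1` as a positive natural number. -/
def pn (j : ℕ) : ℕ+ := ⟨j + 1, j.succ_pos⟩

theorem pn_coe (j : ℕ) : (pn j : ℕ) = j + 1 := rfl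

theorem pn_inj {i j : ℕ} (h : pn i = pn j) : i = j := by
  have := congrArg PNat.val h
  simpa [pn] using this

theorem pn_surj (i : ℕ+) : ∃ j, i = pn j :=
  ⟨i.natPred, PNat.eq (by rw [pn_coe, PNat.natPred_add_one])⟩

theorem newton_succ (R : Type) [CommRing R] (i : ℕ) : newtonPoly R (i + 1) =
    (∑ j ∈ Finset.range i,
        (-1 : MvPolynomial ℕ+ R) ^ j * (X (pn j) : MvPolynomial ℕ+ R) *
          newtonPoly R (i - j))
      + (-1) ^ i * ((i : MvPolynomial ℕ+ R) + 1) *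
        (X (pn i) : MvPolynomial ℕ+ R) := by
  rw [newtonPoly]
  rfl

theorem newton_map {R D : Type} [CommRing R] [CommRing D] (f : MvPolynomial ℕ+ R →+* D) (i : ℕ) :
    f (newtonPoly R (i + 1)) = (∑ j ∈ Finset.range i,
        (-1 : D) ^ j * f (X (pn j)) * f (newtonPoly R (i - j)))
      + (-1) ^ i * ((i : D) + 1) * f (X (pn i)) := by
  rw [newton_succ]
  simp only [map_add, map_sum, map_mul, map_pow, map_neg, map_one, map_natCast]

theorem psum_newton (N : ℕ) (F : Type) [CommRing F] (i : ℕ) :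
    psum (Fin N) F (i + 1) = (∑ j ∈ Finset.range i,
        (-1 : MvPolynomial (Fin N) F) ^ j * esymm (Fin N) F (j + 1) * psum (Fin N) F (i - j))
      + (-1) ^ i * ((i : MvPolynomial (Fin N) F) + 1) * esymm (Fin N) F (i + 1) := by
  have h := mul_esymm_eq_sum (Fin N) F (i + 1)
  rw [Finset.sum_filter, Finset.Nat.sum_antidiagonal_eq_sum_range_succ_mk,
    Finset.sum_range_succ, Finset.sum_range_succ'] at h
  simp only [lt_irrefl, if_false, add_zero, Nat.succ_pos, if_true, pow_zero, esymm_zero, one_mul,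
    Nat.sub_zero, Nat.cast_add, Nat.cast_one] at h
  have h3 : ∑ k ∈ Finset.range i, (if k + 1 < i + 1 then
      (-1) ^ (k + 1) * esymm (Fin N) F (k + 1) * psum (Fin N) F (i + 1 - (k + 1)) else 0) =
      - ∑ j ∈ Finset.range i,
        (-1 : MvPolynomial (Fin N) F) ^ j * esymm (Fin N) F (j + 1) * psum (Fin N) F (i - j) := by
    rw [← Finset.sum_neg_distrib]
    refine Finset.sum_congr rfl fun j hj => ?_
    rw [if_pos (by simpa using hj), Nat.add_sub_add_right]
    ring
  rw [h3] at h
  rw [mul_assoc, h, ← mul_assoc, ← pow_add, Even.neg_one_pow ⟨i + 1, by ring⟩]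
  ring

theorem newton_unique {R D : Type} [CommRing R] [CommRing D] (f : MvPolynomial ℕ+ R →+* D)
    (t : ℕ → D) (ht : ∀ i, t (i + 1) = (∑ j ∈ Finset.range i,
        (-1 : D) ^ j * f (X (pn j)) * t (i - j)) + (-1) ^ i * ((i : D) + 1) * f (X (pn i))) (i : ℕ) :
    f (newtonPoly R (i + 1)) = t (i + 1) := by
  induction i using Nat.strong_induction_on with
  | _ i ih =>
    rw [newton_map, ht]
    congr 1
    refine Finset.sum_congr rfl fun j hj => ?_
    have hj := Finset.mem_range.mp hj
    obtain ⟨d, hd⟩ : ∃ d, i - j = d + 1 := ⟨i - j - 1, by omega⟩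
    rw [hd, ih d (by omega)]

theorem newton_psum (N : ℕ) (F : Type) [CommRing F] (i : ℕ) :
    aeval (fun j : ℕ+ => esymm (Fin N) F j) (newtonPoly F (i + 1)) = psum (Fin N) F (i + 1) := by
  refine newton_unique (aeval (R := F) (fun j : ℕ+ => esymm (Fin N) F j)).toRingHom
    (fun i => psum (Fin N) F i) (fun i => ?_) i
  have hX : ∀ j, (aeval (R := F) (fun j : ℕ+ => esymm (Fin N) F j)).toRingHom (X (pn j)) =
      esymm (Fin N) F (j + 1) := fun j => aeval_X _ _
  simp only [hX]
  exact psum_newton N F i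

theorem newton_supported (F : Type) [CommRing F] (N i : ℕ) (hi : i ≤ N) :
    newtonPoly F i ∈ supported F (Set.range fun j : Fin N => pn j) := by
  induction i using Nat.strong_induction_on with
  | _ i ih =>
    have hX : ∀ j (_ : j < N), X (pn j) ∈
        supported F (Set.range fun j : Fin N => pn j) := by
      intro j hj
      exact Algebra.subset_adjoin ⟨_, ⟨⟨j, hj⟩, rfl⟩, rfl⟩
    have h1 : ∀ j, (-1 : MvPolynomial ℕ+ F) ^ j ∈
        supported F (Set.range fun j : Fin N => pn j) := fun j =>
      pow_mem (neg_mem (one_mem _)) _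
    cases i with
    | zero => rw [newtonPoly]; exact zero_mem _
    | succ i =>
      rw [newton_succ]
      refine add_mem (sum_mem fun j hj => ?_) ?_
      · have hj := Finset.mem_range.mp hj
        exact mul_mem (mul_mem (h1 _) (hX _ (by omega))) (ih _ (by omega) (by omega))
      · exact mul_mem (mul_mem (h1 _) (add_mem (natCast_mem _ _) (one_mem _))) (hX _ (by omega))

theorem newton_frob (F : Type) [CommRing F] (p : ℕ) [Fact p.Prime] [CharP F p] (m : ℕ)
    (hm : 0 < m) : newtonPoly F (p * m) = newtonPoly F m ^ p := by
  have hp : p.Prime := Fact.out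
  set N := p * m with hN
  have hmN : m ≤ N := Nat.le_mul_of_pos_left _ hp.pos
  have hNpos : 0 < N := Nat.mul_pos hp.pos hm
  rw [← sub_eq_zero]
  have hq : newtonPoly F N - newtonPoly F m ^ p ∈
      supported F (Set.range fun j : Fin N => pn j) :=
    sub_mem (newton_supported F N N le_rfl) (pow_mem (newton_supported F N m hmN) _)
  obtain ⟨q, hq'⟩ : ∃ q : MvPolynomial (Fin N) F,
      rename (fun j : Fin N => pn j) q =
        newtonPoly F N - newtonPoly F m ^ p := by
    rw [mem_supported] at hq
    exact exists_rename_eq_of_vars_subset_range _ _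
      (fun a b h => by exact Fin.ext (pn_inj h)) hq
  have h0 : aeval (fun j : ℕ+ => esymm (Fin N) F j) (newtonPoly F N - newtonPoly F m ^ p) = 0 := by
    obtain ⟨a, ha⟩ : ∃ a, N = a + 1 := ⟨N - 1, by omega⟩
    obtain ⟨b, hb⟩ : ∃ b, m = b + 1 := ⟨m - 1, by omega⟩
    have e1 : aeval (fun j : ℕ+ => esymm (Fin N) F j) (newtonPoly F N) = psum (Fin N) F N := by
      have := newton_psum N F a
      rwa [← ha] at this
    have e2 : aeval (fun j : ℕ+ => esymm (Fin N) F j) (newtonPoly F m) = psum (Fin N) F m := by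
      have := newton_psum N F b
      rwa [← hb] at this
    rw [map_sub, map_pow, e1, e2, psum, psum, sum_pow_char]
    rw [sub_eq_zero]
    refine Finset.sum_congr rfl fun j _ => ?_
    rw [← pow_mul]
    congr 1
    rw [hN, mul_comm]
  rw [← hq', aeval_rename] at h0
  have h1 : esymmAlgHom (Fin N) F N q = 0 := by
    apply Subtype.ext
    rw [esymmAlgHom_apply]
    exact h0
  have h2 : q = 0 := esymmAlgHom_fin_injective F le_rfl (by rw [h1, map_zero])
  rw [← hq', h2, map_zero]

theorem rec_frob {D : Type} [CommRing D] (p : ℕ) [Fact p.Prime] [CharP D p] (n : ℕ) (c τ : ℕ → D)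
    (hc : c 0 = 1)
    (hτ : ∀ i, ∑ j ∈ Finset.range (n + 1), c j * τ (n + i - j) = 0)
    (h0 : ∀ m < n, τ (p * m) = τ m ^ p) (m : ℕ) : τ (p * m) = τ m ^ p := by
  classical
  have hp : p.Prime := Fact.out
  let ev : Polynomial D →ₗ[D] D := (Polynomial.basisMonomials D).constr D τ
  have hev : ∀ i a, ev (Polynomial.C a * Polynomial.X ^ i) = a * τ i := by
    intro i a
    have := (Polynomial.basisMonomials D).constr_basis D τ i
    rw [Polynomial.coe_basisMonomials] at this
    rw [Polynomial.C_mul', map_smul, smul_eq_mul, Polynomial.X_pow_eq_monomial]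
    exact congrArg _ this
  let χ : Polynomial D := ∑ j ∈ Finset.range (n + 1), Polynomial.C (c j) * Polynomial.X ^ (n - j)
  have hχ : ∀ q, ev (χ * q) = 0 := by
    intro q
    induction q using Polynomial.induction_on' with
    | add a b ha hb => rw [mul_add, map_add, ha, hb, add_zero]
    | monomial i a =>
      rw [← Polynomial.C_mul_X_pow_eq_monomial, mul_left_comm, Polynomial.C_mul', map_smul,
        Finset.sum_mul, map_sum]
      rw [← smul_zero a, ← hτ i]
      congr 1
      refine Finset.sum_congr rfl fun j hj => ?_
      have := Finset.mem_range.mp hj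
      rw [mul_assoc, ← pow_add, hev]
      congr 2; omega
  have hχp : χ ^ p = ∑ j ∈ Finset.range (n + 1),
      Polynomial.C (c j ^ p) * Polynomial.X ^ (p * (n - j)) := by
    rw [sum_pow_char]
    refine Finset.sum_congr rfl fun j hj => ?_
    rw [mul_pow, ← pow_mul, mul_comm p, map_pow]
  have hdec : ∀ i, ∑ j ∈ Finset.range (n + 1), c j ^ p * τ (p * (n + i - j)) = 0 := by
    intro i
    have h := hχ (χ ^ (p - 1) * Polynomial.X ^ (p * i))
    rw [← mul_assoc, ← pow_succ', Nat.sub_add_cancel hp.one_le, hχp, Finset.sum_mul, map_sum] at h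
    rw [← h]
    refine Finset.sum_congr rfl fun j hj => ?_
    have := Finset.mem_range.mp hj
    rw [mul_assoc, ← pow_add, hev, ← mul_add]
    congr 3; omega
  induction m using Nat.strong_induction_on with
  | _ m ih =>
    by_cases hmn : m < n
    · exact h0 m hmn
    · obtain ⟨i, rfl⟩ : ∃ i, m = n + i := ⟨m - n, by omega⟩
      have h1 := hdec i
      have h2 : ∑ j ∈ Finset.range (n + 1), c j ^ p * τ (n + i - j) ^ p = 0 := by
        have := congrArg (· ^ p) (hτ i)
        simp only [sum_pow_char, zero_pow hp.ne_zero, mul_pow] at this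
        exact this
      rw [Finset.sum_range_succ'] at h1 h2
      have h3 : ∑ k ∈ Finset.range n, c (k + 1) ^ p * τ (p * (n + i - (k + 1))) =
          ∑ k ∈ Finset.range n, c (k + 1) ^ p * τ (n + i - (k + 1)) ^ p := by
        refine Finset.sum_congr rfl fun j hj => ?_
        have := Finset.mem_range.mp hj
        rw [ih _ (by omega)]
      rw [h3] at h1
      have := h1.trans h2.symm
      simpa [hc] using this

theorem neg_one_sign {P : Type} [CommRing P] (i : ℕ) : (-1 : P) ^ i * (-1) ^ i = 1 := by
  rw [← mul_pow]; simp

/-- The generic linear recurrent sequence. -/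
noncomputable def tau {D : Type} [CommRing D] (n : ℕ) (c y : ℕ → D) (k : D) : ℕ → D
  | i => if h : i = 0 then k else if i < n then y i else
      - ∑ j : Fin n, c (j + 1) * tau n c y k (i - (j + 1))
  decreasing_by omega

section tau
variable {D : Type} [CommRing D] (n : ℕ) (c y : ℕ → D) (k : D)

theorem tau_zero : tau n c y k 0 = k := by rw [tau]; simp

theorem tau_lt (i : ℕ) (h0 : i ≠ 0) (h : i < n) : tau n c y k i = y i := by
  rw [tau]; simp [h0, h]

theorem tau_ge (hn : 1 ≤ n) (i : ℕ) (h : n ≤ i) : tau n c y k i =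
    - ∑ j ∈ Finset.range n, c (j + 1) * tau n c y k (i - (j + 1)) := by
  rw [tau, dif_neg (by omega), if_neg (by omega),
    Finset.sum_range (fun j => c (j + 1) * tau n c y k (i - (j + 1)))]

theorem tau_rec (hn : 1 ≤ n) (hc : c 0 = 1) (i : ℕ) :
    ∑ j ∈ Finset.range (n + 1), c j * tau n c y k (n + i - j) = 0 := by
  rw [Finset.sum_range_succ', hc, one_mul, Nat.sub_zero, tau_ge n c y k hn (n + i) (by omega)]
  ring

theorem tau_map (hn : 1 ≤ n) {A : Type} [CommRing A] (f : D →+* A) (s : ℕ → A) (hs0 : s 0 = f k)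
    (hsy : ∀ m < n, s m = f (y m)) (hc : c 0 = 1)
    (hs : ∀ i, ∑ j ∈ Finset.range (n + 1), f (c j) * s (n + i - j) = 0) (i : ℕ) :
    f (tau n c y k i) = s i := by
  induction i using Nat.strong_induction_on with
  | _ i ih =>
    by_cases h0 : i = 0
    · rw [h0, tau_zero, hs0]
    by_cases h : i < n
    · rw [tau_lt n c y k i h0 h, hsy i h]
    obtain ⟨a, rfl⟩ : ∃ a, i = n + a := ⟨i - n, by omega⟩
    have h1 := hs a
    rw [Finset.sum_range_succ', hc, map_one, one_mul, Nat.sub_zero] at h1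
    rw [tau_ge n c y k hn _ (by omega), map_neg, map_sum, ← add_eq_zero_iff_neg_eq, ← h1]
    congr 1
    refine Finset.sum_congr rfl fun j hj => ?_
    rw [map_mul, ih _ (by omega)]

end tau

theorem tau_ltDeg {R : Type} [CommRing R] (n : ℕ) (hn : 1 ≤ n) (c : ℕ → R)
    (y : ℕ → MvPolynomial (Fin n) R) (hy : ∀ i < n, y i ∈ ltDeg R (Fin n) 2) (k : ℤ) (i : ℕ) :
    tau n (fun j => C (c j)) y (k : MvPolynomial (Fin n) R) i ∈ ltDeg R (Fin n) 2 := by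
  induction i using Nat.strong_induction_on with
  | _ i ih =>
    by_cases h0 : i = 0
    · rw [h0, tau_zero]
      have := ltDeg_mono (show 1 ≤ 2 by norm_num)
        (monomial_mem_ltDeg (0 : Fin n →₀ ℕ) ((k : R)))
      rwa [← C_apply, map_intCast] at this
    by_cases h : i < n
    · rw [tau_lt n _ y _ i h0 h]; exact hy i h
    rw [tau_ge n _ y _ hn i (by omega)]
    refine neg_mem (sum_mem fun j hj => ?_)
    rw [C_mul']
    exact Submodule.smul_mem _ _ (ih _ (by omega))

/-- the variables `c_m` in `F[c_1, …, c_n]` -/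
noncomputable def cR (F : Type) [CommRing F] (n m : ℕ) : MvPolynomial (Fin n) F :=
  if h0 : m = 0 then 1
  else if h : m ≤ n then X ⟨m - 1, by omega⟩ else 0

theorem cvar_eq (F : Type) [CommRing F] (n m : ℕ) : cvar F n m = rename Sum.inl (cR F n m) := by
  unfold cvar cR
  split_ifs <;> simp

/-- the signed sequence -/
noncomputable def sg (F : Type) [CommRing F] (n : ℕ) (k : ℤ) {D : Type} [CommRing D]
    (g : MvPolynomial (Fin n ⊕ ℕ+) F →+* D) (m : ℕ) : D :=
  if m = 0 then (k : D) else (-1) ^ m * g (rename Sum.inr (newtonPoly F m))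

theorem hRel_map (F : Type) [CommRing F] (n : ℕ) (k : ℤ) {D : Type} [CommRing D]
    (g : MvPolynomial (Fin n ⊕ ℕ+) F →+* D) (i : ℕ) :
    g (hRel F n k (n + i)) =
      ∑ j ∈ Finset.range (n + 1), g (cvar F n j) * sg F n k g (n + i - j) := by
  have h1 : g (hRel F n k (n + i)) =
      ∑ j ∈ Finset.range (n + i + 1), g (cvar F n (n + i - j)) * sg F n k g j := by
    rw [Finset.sum_range_succ', hRel, map_add, map_sum, add_comm]
    congr 1
    · refine Finset.sum_congr rfl fun j hj => ?_
      simp only [sg, Nat.succ_ne_zero, if_false, map_mul, map_pow, map_neg, map_one]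
      ring
    · simp [sg, mul_comm]
  rw [h1, ← Finset.sum_range_reflect]
  have h2 : ∀ j ∈ Finset.range (n + i + 1),
      g (cvar F n (n + i - (n + i + 1 - 1 - j))) * sg F n k g (n + i + 1 - 1 - j) =
      g (cvar F n j) * sg F n k g (n + i - j) := by
    intro j hj
    have := Finset.mem_range.mp hj
    rw [show n + i - (n + i + 1 - 1 - j) = j by omega, show n + i + 1 - 1 - j = n + i - j by omega]
  rw [Finset.sum_congr rfl h2]
  symm
  refine Finset.sum_subset (fun j hj => ?_) fun j hj hj' => ?_
  · simp at *; omega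
  · have : cvar F n j = 0 := by
      simp at hj'
      rw [cvar, dif_neg (by omega), dif_neg (by omega)]
    rw [this, map_zero, zero_mul]

/-- Inverting the Newton recursion. -/
noncomputable def xi {P : Type} [CommRing P] (u z t : ℕ → P) : ℕ → P
  | i => z i + u i * ((-1) ^ i * (t (i + 1) -
      ∑ j : Fin i, (-1) ^ (j : ℕ) * xi u z t j * t (i - j)))
  decreasing_by omega

theorem xi_eq {P : Type} [CommRing P] (u z t : ℕ → P) (i : ℕ) :
    xi u z t i = z i + u i * ((-1) ^ i * (t (i + 1) -
      ∑ j ∈ Finset.range i, (-1) ^ j * xi u z t j * t (i - j))) := by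
  rw [xi, Finset.sum_range (fun j => (-1) ^ j * xi u z t j * t (i - j))]

/-- The ideal of relations. -/
noncomputable abbrev IhI (F : Type) [Field F] (n : ℕ) (k : ℤ) :
    Ideal (MvPolynomial (Fin n ⊕ ℕ+) F) :=
  Ideal.span (Set.range fun j : ℕ => hRel F n k (n + j))

theorem weaklyRegular_of_model (n : ℕ) (k : ℤ) (F : Type) [Field F] (D : Type)
    [CommRing D] [Algebra (MvPolynomial (Fin n) F) D] [Module.Flat (MvPolynomial (Fin n) F) D]
    (τ : ℕ → D) (hτ0 : τ 0 = k)
    (hrec : ∀ i, ∑ j ∈ Finset.range (n + 1),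
      algebraMap (MvPolynomial (Fin n) F) D (cR F n j) * τ (n + i - j) = 0)
    (hfrob : ∀ p : ℕ, p.Prime → CharP F p → ∀ m, τ (p * m) = τ m ^ p)
    (θ : D →+* MvPolynomial (Fin n ⊕ ℕ+) F ⧸ IhI F n k)
    (hθ : ∀ m, θ (τ m) = sg F n k (Ideal.Quotient.mk (IhI F n k)) m)
    (hθ2 : ∀ r, θ (algebraMap _ D r) = Ideal.Quotient.mk (IhI F n k) (rename Sum.inl r)) :
    RingTheory.Sequence.IsWeaklyRegular (MvPolynomial (Fin n ⊕ ℕ+) F ⧸ IhI F n k)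
      (List.ofFn fun m : Fin n => Ideal.Quotient.mk (IhI F n k) (X (Sum.inl m))) := by
  classical
  let R := MvPolynomial (Fin n) F
  let P := MvPolynomial ℕ+ D
  have hflat : Module.Flat R P := Module.Flat.trans R D P
  let α : F →+* P := (algebraMap R P).comp C
  let u : ℕ → P := fun i => α (((i : F) + 1)⁻¹)
  let z : ℕ → P := fun i => if ((i : F) + 1) = 0 then X (pn i) else 0
  let t : ℕ → P := fun m => (-1) ^ m * C (τ m)
  let ξ := xi u z t
  let G : MvPolynomial (Fin n ⊕ ℕ+) F →+* P :=
    eval₂Hom α (Sum.elim (fun i => algebraMap R P (X i)) (fun i => ξ i.natPred))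
  let f : MvPolynomial ℕ+ F →+* P := G.comp (rename Sum.inr).toRingHom
  have hGl : ∀ r, G (rename Sum.inl r) = algebraMap R P r := by
    intro r
    have : G.comp (rename Sum.inl).toRingHom = algebraMap R P := by
      apply MvPolynomial.ringHom_ext
      · intro a; simp [G, α]
      · intro i; simp [G]
    exact congrArg (fun h => h r) this
  have hfX : ∀ j, f (X (pn j)) = ξ j := by
    intro j
    have : (pn j).natPred = j := rfl
    simp [f, G, this]
  have hu : ∀ i : ℕ, (i : F) + 1 ≠ 0 → u i * ((i : P) + 1) = 1 := by
    intro i hi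
    have : ((i : P) + 1) = α ((i : F) + 1) := by simp
    rw [this, ← map_mul, inv_mul_cancel₀ hi, map_one]
  have hsign : ∀ i, ((-1 : P) ^ i * (-1) ^ i) = 1 := by
    intro i; exact neg_one_sign i
  have hnewton : ∀ i, f (newtonPoly F (i + 1)) = t (i + 1) := by
    intro i
    induction i using Nat.strong_induction_on with
    | _ i ih =>
      by_cases hi : (i : F) + 1 = 0
      · have hcast : ((i + 1 : ℕ) : F) = 0 := by exact_mod_cast hi
        obtain ⟨p, hp⟩ := CharP.exists F
        have hdvd := (CharP.cast_eq_zero_iff F p (i + 1)).mp hcast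
        have hpp : p.Prime := by
          rcases CharP.char_is_prime_or_zero F p with h | h
          · exact h
          · rw [h] at hdvd; simp at hdvd
        obtain ⟨m, hm⟩ := hdvd
        have hm0 : 0 < m := by
          rcases Nat.eq_zero_or_pos m with h | h
          · rw [h] at hm; simp at hm
          · exact h
        haveI : Fact p.Prime := ⟨hpp⟩
        have hlt : m < i + 1 := by rw [hm]; exact lt_mul_of_one_lt_left hm0 hpp.one_lt
        obtain ⟨b, rfl⟩ : ∃ b, m = b + 1 := ⟨m - 1, by omega⟩
        rw [hm, newton_frob F p (b + 1) hm0, map_pow, ih b (by omega)]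
        simp only [t]
        rw [hfrob p hpp hp, mul_pow, ← pow_mul, mul_comm p, map_pow]
      · rw [newton_map]
        have h1 : ∀ j ∈ Finset.range i, (-1 : P) ^ j * f (X (pn j)) * f (newtonPoly F (i - j)) =
            (-1) ^ j * ξ j * t (i - j) := by
          intro j hj
          have hj := Finset.mem_range.mp hj
          obtain ⟨d, hd⟩ : ∃ d, i - j = d + 1 := ⟨i - j - 1, by omega⟩
          rw [hfX, hd, ih d (by omega)]
        rw [Finset.sum_congr rfl h1, hfX]
        have h2 : ξ i = _ := xi_eq u z t i
        have h3 : z i = 0 := if_neg hi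
        rw [h3, zero_add] at h2
        rw [h2]
        have e : (-1) ^ i * ((i : P) + 1) * (u i * ((-1) ^ i * (t (i + 1) -
            ∑ j ∈ Finset.range i, (-1) ^ j * ξ j * t (i - j)))) =
            ((-1) ^ i * (-1) ^ i) * (u i * ((i : P) + 1)) * (t (i + 1) -
            ∑ j ∈ Finset.range i, (-1) ^ j * ξ j * t (i - j)) := by ring
        rw [e, hsign, hu i hi]
        ring
  have hsg : ∀ m, sg F n k G m = C (τ m) := by
    intro m
    rw [sg]
    split_ifs with h
    · rw [h, hτ0, map_intCast]
    · obtain ⟨b, rfl⟩ : ∃ b, m = b + 1 := ⟨m - 1, by omega⟩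
      have : G (rename Sum.inr (newtonPoly F (b + 1))) = t (b + 1) := hnewton b
      rw [this]
      simp only [t]
      rw [← mul_assoc, hsign, one_mul]
  have hker : ∀ a ∈ IhI F n k, G a = 0 := by
    intro a ha
    have : IhI F n k ≤ RingHom.ker G := by
      rw [Ideal.span_le]
      rintro _ ⟨i, rfl⟩
      change G _ = 0
      rw [hRel_map]
      have h2 := congrArg (C : D →+* P) (hrec i)
      rw [map_sum, map_zero] at h2
      rw [← h2]
      refine Finset.sum_congr rfl fun j _ => ?_
      rw [hsg, cvar_eq, hGl, map_mul]
      rfl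
    exact this ha
  let φ := Ideal.Quotient.lift (IhI F n k) G hker
  let ψ : P →+* MvPolynomial (Fin n ⊕ ℕ+) F ⧸ IhI F n k :=
    eval₂Hom θ (fun i => Ideal.Quotient.mk (IhI F n k) (X (Sum.inr i)))
  have hψR : ∀ r, ψ (algebraMap R P r) = Ideal.Quotient.mk (IhI F n k) (rename Sum.inl r) := by
    intro r
    rw [← hθ2]
    exact eval₂Hom_C _ _ _
  have hψt : ∀ m, ψ (t (m + 1)) =
      Ideal.Quotient.mk (IhI F n k) (rename Sum.inr (newtonPoly F (m + 1))) := by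
    intro m
    have : ψ (C (τ (m + 1))) = θ (τ (m + 1)) := eval₂Hom_C _ _ _
    simp only [t]
    rw [map_mul, this, hθ, sg, if_neg (Nat.succ_ne_zero m), map_pow, map_neg, map_one,
      ← mul_assoc, neg_one_sign, one_mul]
  have hψX : ∀ i, ψ (X i) = Ideal.Quotient.mk (IhI F n k) (X (Sum.inr i)) := by
    intro i; exact eval₂Hom_X' _ _ _
  have hψξ : ∀ i, ψ (ξ i) = Ideal.Quotient.mk (IhI F n k) (X (Sum.inr (pn i))) := by
    intro i
    induction i using Nat.strong_induction_on with
    | _ i ih =>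
      have h2 : ξ i = _ := xi_eq u z t i
      by_cases hi : (i : F) + 1 = 0
      · have h3 : z i = X (pn i) := if_pos hi
        have h4 : u i = 0 := by simp [u, hi]
        rw [h2, h3, h4, zero_mul, add_zero, hψX]
      · have h3 : z i = 0 := if_neg hi
        have hN := newton_map ((Ideal.Quotient.mk (IhI F n k)).comp
          (rename (R := F) (Sum.inr : ℕ+ → Fin n ⊕ ℕ+)).toRingHom) i
        have h5 : ψ (t (i + 1)) -
            ψ (∑ j ∈ Finset.range i, (-1) ^ j * ξ j * t (i - j)) =
            (-1) ^ i * ((i : MvPolynomial (Fin n ⊕ ℕ+) F ⧸ IhI F n k) + 1) *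
            Ideal.Quotient.mk (IhI F n k) (X (Sum.inr (pn i))) := by
          rw [hψt, sub_eq_iff_eq_add', map_sum]
          refine hN.trans ?_
          congr 1
          · refine Finset.sum_congr rfl fun j hj => ?_
            have hj := Finset.mem_range.mp hj
            obtain ⟨d, hd⟩ : ∃ d, i - j = d + 1 := ⟨i - j - 1, by omega⟩
            rw [hd, map_mul, map_mul, hψt, ih j hj]
            simp
          · simp
        have h6 := congrArg ψ (hu i hi)
        rw [map_mul, map_add, map_natCast, map_one] at h6
        rw [h2, h3, zero_add, map_mul, map_mul, map_sub, h5, map_pow, map_neg, map_one]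
        have h7 : ((-1 : MvPolynomial (Fin n ⊕ ℕ+) F ⧸ IhI F n k) ^ i * (-1) ^ i) = 1 := by
          exact neg_one_sign i
        linear_combination (Ideal.Quotient.mk (IhI F n k) (X (Sum.inr (pn i)))) *
          (ψ (u i) * ((i : MvPolynomial (Fin n ⊕ ℕ+) F ⧸ IhI F n k) + 1)) * h7 +
          (Ideal.Quotient.mk (IhI F n k) (X (Sum.inr (pn i)))) * h6
  have hψφ : ψ.comp φ = RingHom.id _ := by
    apply Ideal.Quotient.ringHom_ext
    apply MvPolynomial.ringHom_ext
    · intro a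
      have : φ (Ideal.Quotient.mk (IhI F n k) (C a)) = algebraMap R P (C a) := by
        change G (C a) = _
        exact eval₂Hom_C _ _ _
      change ψ (φ (Ideal.Quotient.mk (IhI F n k) (C a))) = _
      rw [this, hψR, rename_C]
      rfl
    · rintro (i | i)
      · have : φ (Ideal.Quotient.mk (IhI F n k) (X (Sum.inl i))) = algebraMap R P (X i) := by
          change G (X (Sum.inl i)) = _
          exact eval₂Hom_X' _ _ _
        change ψ (φ (Ideal.Quotient.mk (IhI F n k) (X (Sum.inl i)))) = _
        rw [this, hψR, rename_X]
        rfl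
      · obtain ⟨j, rfl⟩ := pn_surj i
        have : φ (Ideal.Quotient.mk (IhI F n k) (X (Sum.inr (pn j)))) = ξ j := by
          change G (X (Sum.inr (pn j))) = _
          exact eval₂Hom_X' _ _ _
        change ψ (φ (Ideal.Quotient.mk (IhI F n k) (X (Sum.inr (pn j))))) = _
        rw [this, hψξ]
        rfl
  have hfin := weaklyRegular_of_retract (R := R) (P := P)
    ((Ideal.Quotient.mk (IhI F n k)).comp (rename Sum.inl).toRingHom) φ ψ
    (fun a => congrArg (fun h => h a) hψφ) (fun r => hGl r) _ (vars_weaklyRegular n F)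
  have hlist : (List.ofFn fun i : Fin n => (X i : R)).map
      ((Ideal.Quotient.mk (IhI F n k)).comp (rename Sum.inl).toRingHom) =
      List.ofFn fun m : Fin n => Ideal.Quotient.mk (IhI F n k) (X (Sum.inl m)) := by
    rw [List.map_ofFn]
    congr 1
    funext m
    simp
  rw [hlist] at hfin
  exact hfin

/-- Any ring hom killing the `c_j` sends `h_i` to `± s_i`. -/
theorem hRel_of_kill (n : ℕ) (hn : 1 ≤ n) (k : ℤ) (F : Type) [Field F] {D : Type} [CommRing D]
    (g : MvPolynomial (Fin n ⊕ ℕ+) F →+* D) (hg : ∀ j, g (cvar F n (j + 1)) = 0) (i : ℕ) :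
    g (hRel F n k (n + i)) = (-1) ^ (n + i) * g (rename Sum.inr (newtonPoly F (n + i))) := by
  rw [hRel_map, Finset.sum_range_succ', Finset.sum_eq_zero, zero_add, Nat.sub_zero, sg,
    if_neg (by omega), cvar, dif_pos rfl, map_one, one_mul]
  intro j _
  rw [hg, zero_mul]

theorem newton_of_kill (n : ℕ) (hn : 1 ≤ n) (k : ℤ) (F : Type) [Field F] {D : Type} [CommRing D]
    (g : MvPolynomial (Fin n ⊕ ℕ+) F →+* D) (hg : ∀ j, g (cvar F n (j + 1)) = 0) (i : ℕ)
    (h2 : g (hRel F n k (n + i)) = 0) : g (rename Sum.inr (newtonPoly F (n + i))) = 0 := by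
  have h1 := hRel_of_kill n hn k F g hg i
  rw [h2] at h1
  have h3 := congrArg (fun x => (-1) ^ (n + i) * x) h1
  simp only [mul_zero] at h3
  rw [← mul_assoc, neg_one_sign, one_mul] at h3
  exact h3.symm

theorem quot_iso (n : ℕ) (hn : 1 ≤ n) (k : ℤ) (F : Type) [Field F]
    (Jc : Ideal (MvPolynomial (Fin n ⊕ ℕ+) F ⧸ IhI F n k))
    (hJ : Jc = Ideal.span (Set.range fun m : Fin n =>
      Ideal.Quotient.mk (IhI F n k) (X (Sum.inl m))))
    (Is : Ideal (MvPolynomial ℕ+ F))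
    (hI : Is = Ideal.span (Set.range fun j : ℕ => newtonPoly F (n + j))) :
    ∃ e : ((MvPolynomial (Fin n ⊕ ℕ+) F ⧸ IhI F n k) ⧸ Jc) ≃+* (MvPolynomial ℕ+ F ⧸ Is),
        ∀ i : ℕ+,
          e (Ideal.Quotient.mk Jc (Ideal.Quotient.mk (IhI F n k) (X (Sum.inr i))))
            = Ideal.Quotient.mk Is (X i) := by
  let G : MvPolynomial (Fin n ⊕ ℕ+) F →+* MvPolynomial ℕ+ F ⧸ Is :=
    eval₂Hom ((Ideal.Quotient.mk Is).comp C)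
      (Sum.elim (fun _ => 0) (fun i => Ideal.Quotient.mk Is (X i)))
  have hGC : ∀ a, G (C a) = Ideal.Quotient.mk Is (C a) := fun a => eval₂Hom_C _ _ _
  have hGl : ∀ i, G (X (Sum.inl i)) = 0 := fun i => eval₂Hom_X' _ _ _
  have hGr : ∀ i, G (X (Sum.inr i)) = Ideal.Quotient.mk Is (X i) := fun i => eval₂Hom_X' _ _ _
  have hGren : ∀ q, G (rename Sum.inr q) = Ideal.Quotient.mk Is q := by
    intro q
    have : G.comp (rename Sum.inr).toRingHom = Ideal.Quotient.mk Is := by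
      apply MvPolynomial.ringHom_ext
      · intro a
        change G (rename Sum.inr (C a)) = _
        rw [rename_C, hGC]
      · intro i
        change G (rename Sum.inr (X i)) = _
        rw [rename_X, hGr]
    exact congrArg (fun h => h q) this
  have hGc : ∀ j, G (cvar F n (j + 1)) = 0 := by
    intro j
    rw [cvar, dif_neg (Nat.succ_ne_zero j)]
    split_ifs
    · exact hGl _
    · exact map_zero _
  have hIs : ∀ j, Ideal.Quotient.mk Is (newtonPoly F (n + j)) = 0 := by
    intro j
    rw [Ideal.Quotient.eq_zero_iff_mem, hI]
    exact Ideal.subset_span ⟨j, rfl⟩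
  have hker1 : ∀ a ∈ IhI F n k, G a = 0 := by
    intro a ha
    have : IhI F n k ≤ RingHom.ker G := by
      rw [Ideal.span_le]
      rintro _ ⟨i, rfl⟩
      change G _ = 0
      rw [hRel_of_kill n hn k F G hGc, hGren, hIs, mul_zero]
    exact this ha
  let G1 : (MvPolynomial (Fin n ⊕ ℕ+) F ⧸ IhI F n k) →+* _ :=
    Ideal.Quotient.lift (IhI F n k) G hker1
  have hG1 : ∀ a, G1 (Ideal.Quotient.mk _ a) = G a := fun a => rfl
  have hker2 : ∀ a ∈ Jc, G1 a = 0 := by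
    intro a ha
    have : Jc ≤ RingHom.ker G1 := by
      rw [hJ, Ideal.span_le]
      rintro _ ⟨i, rfl⟩
      change G1 _ = 0
      exact hGl i
    exact this ha
  let f1 := Ideal.Quotient.lift Jc G1 hker2
  let H : MvPolynomial (Fin n ⊕ ℕ+) F →+* ((MvPolynomial (Fin n ⊕ ℕ+) F ⧸ IhI F n k) ⧸ Jc) :=
    (Ideal.Quotient.mk Jc).comp (Ideal.Quotient.mk (IhI F n k))
  have hHl : ∀ i, H (X (Sum.inl i)) = 0 := by
    intro i
    refine Ideal.Quotient.eq_zero_iff_mem.mpr ?_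
    rw [hJ]
    exact Ideal.subset_span ⟨i, rfl⟩
  have hHc : ∀ j, H (cvar F n (j + 1)) = 0 := by
    intro j
    rw [cvar, dif_neg (Nat.succ_ne_zero j)]
    split_ifs
    · exact hHl _
    · exact map_zero _
  let H2 : MvPolynomial ℕ+ F →+* ((MvPolynomial (Fin n ⊕ ℕ+) F ⧸ IhI F n k) ⧸ Jc) :=
    H.comp (rename Sum.inr).toRingHom
  have hker3 : ∀ a ∈ Is, H2 a = 0 := by
    intro a ha
    have : Is ≤ RingHom.ker H2 := by
      rw [hI, Ideal.span_le]
      rintro _ ⟨i, rfl⟩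
      change H (rename Sum.inr (newtonPoly F (n + i))) = 0
      have h2 : H (hRel F n k (n + i)) = 0 := by
        change Ideal.Quotient.mk Jc (Ideal.Quotient.mk (IhI F n k) _) = 0
        have h4 : Ideal.Quotient.mk (IhI F n k) (hRel F n k (n + i)) = 0 :=
          Ideal.Quotient.eq_zero_iff_mem.mpr (Ideal.subset_span ⟨i, rfl⟩)
        rw [h4, map_zero]
      exact @newton_of_kill n hn k F _ ((MvPolynomial (Fin n ⊕ ℕ+) F ⧸ IhI F n k) ⧸ Jc)
        (Ideal.Quotient.commRing Jc) H hHc i h2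
    exact this ha
  let f2 := Ideal.Quotient.lift Is H2 hker3
  refine ⟨RingEquiv.ofRingHom f1 f2 ?_ ?_, ?_⟩
  · apply Ideal.Quotient.ringHom_ext
    apply RingHom.ext
    intro a
    change G (rename Sum.inr a) = _
    rw [hGren]
    rfl
  · apply Ideal.Quotient.ringHom_ext
    apply Ideal.Quotient.ringHom_ext
    apply MvPolynomial.ringHom_ext
    · intro a
      change f2 (G (C a)) = H (C a)
      rw [hGC]
      change H (rename Sum.inr (C a)) = _
      rw [rename_C]
    · rintro (i | i)
      · change f2 (G (X (Sum.inl i))) = H (X (Sum.inl i))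
        rw [hGl, hHl, map_zero]
      · change f2 (G (X (Sum.inr i))) = H (X (Sum.inr i))
        rw [hGr]
        change H (rename Sum.inr (X i)) = _
        rw [rename_X]
  · intro i
    exact hGr i

theorem Is_ne_top (n : ℕ) (F : Type) [Field F] :
    Ideal.span (Set.range fun j : ℕ => newtonPoly F (n + j)) ≠ ⊤ := by
  let g : MvPolynomial ℕ+ F →+* F := eval₂Hom (RingHom.id F) (fun _ => 0)
  have hg : ∀ i, g (X i) = 0 := fun i => eval₂Hom_X' _ _ _
  have h : ∀ i, g (newtonPoly F i) = 0 := by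
    intro i
    cases i with
    | zero => rw [newtonPoly, map_zero]
    | succ i =>
      rw [newton_map, hg, mul_zero, add_zero]
      refine Finset.sum_eq_zero fun j _ => ?_
      rw [hg, mul_zero, zero_mul]
  have hle : Ideal.span (Set.range fun j : ℕ => newtonPoly F (n + j)) ≤ RingHom.ker g := by
    rw [Ideal.span_le]
    rintro _ ⟨i, rfl⟩
    exact h _
  intro htop
  rw [htop] at hle
  have : g 1 = 0 := hle (Submodule.mem_top)
  rw [map_one] at this
  exact one_ne_zero this

theorem weaklyRegular_charP (n : ℕ) (k : ℤ) (F : Type) [Field F] (p : ℕ) (hp : p.Prime)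
    [hcp : CharP F p] (P : Type) [CommRing P] [Algebra (MvPolynomial (Fin n) F) P] (I : Ideal P)
    [Module.Flat (MvPolynomial (Fin n) F) (P ⧸ I)]
    (τ : ℕ → P) (hτ0 : τ 0 = k)
    (hrec : ∀ i, ∑ j ∈ Finset.range (n + 1),
      algebraMap (MvPolynomial (Fin n) F) P (cR F n j) * τ (n + i - j) = 0)
    (hI : ∀ m, m ≠ 0 → m < n → τ m ^ p - τ (p * m) ∈ I)
    (θ : P →+* MvPolynomial (Fin n ⊕ ℕ+) F ⧸ IhI F n k)
    (hker : ∀ a ∈ I, θ a = 0)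
    (hθ : ∀ m, θ (τ m) = sg F n k (Ideal.Quotient.mk (IhI F n k)) m)
    (hθ2 : ∀ r, θ (algebraMap _ P r) = Ideal.Quotient.mk (IhI F n k) (rename Sum.inl r)) :
    RingTheory.Sequence.IsWeaklyRegular (MvPolynomial (Fin n ⊕ ℕ+) F ⧸ IhI F n k)
      (List.ofFn fun m : Fin n => Ideal.Quotient.mk (IhI F n k) (X (Sum.inl m))) := by
  have : Fact p.Prime := ⟨hp⟩
  have hkF : (k : F) ^ p = k := by
    have := map_intCast (frobenius F p) k
    rwa [frobenius_def] at this
  have hrecD : ∀ i, ∑ j ∈ Finset.range (n + 1),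
      algebraMap (MvPolynomial (Fin n) F) (P ⧸ I) (cR F n j) *
        Ideal.Quotient.mk I (τ (n + i - j)) = 0 := by
    intro i
    have := congrArg (Ideal.Quotient.mk I) (hrec i)
    rw [map_sum, map_zero] at this
    rw [← this]
    refine Finset.sum_congr rfl fun j _ => ?_
    rw [map_mul]
    rfl
  refine weaklyRegular_of_model n k F (P ⧸ I) (fun m => Ideal.Quotient.mk I (τ m)) ?_ hrecD ?_
    (Ideal.Quotient.lift I θ hker) (fun m => hθ m) (fun r => hθ2 r)
  · change Ideal.Quotient.mk I (τ 0) = _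
    rw [hτ0, map_intCast]
  · intro q hq hcq m
    obtain rfl : q = p := CharP.eq F hcq hcp
    rcases subsingleton_or_nontrivial (P ⧸ I) with hsub | hnt
    · exact Subsingleton.elim _ _
    let β : F →+* P ⧸ I := (algebraMap (MvPolynomial (Fin n) F) (P ⧸ I)).comp C
    have : CharP (P ⧸ I) q := charP_of_injective_ringHom β.injective q
    refine rec_frob q n (fun j => algebraMap (MvPolynomial (Fin n) F) (P ⧸ I) (cR F n j))
      (fun m => Ideal.Quotient.mk I (τ m)) ?_ hrecD ?_ m
    · simp [cR]
    · intro m hm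
      change Ideal.Quotient.mk I (τ (q * m)) = Ideal.Quotient.mk I (τ m) ^ q
      by_cases hm0 : m = 0
      · rw [hm0, mul_zero, hτ0, map_intCast, ← map_intCast β, ← map_pow, hkF]
      · rw [← map_pow, eq_comm, Ideal.Quotient.eq]
        exact hI m hm0 hm

theorem sg_frob (F : Type) [Field F] (n : ℕ) (k : ℤ) (p : ℕ) (hp : p.Prime) [CharP F p]
    {D : Type} [CommRing D] (g : MvPolynomial (Fin n ⊕ ℕ+) F →+* D) (m : ℕ) :
    sg F n k g m ^ p = sg F n k g (p * m) := by
  have : Fact p.Prime := ⟨hp⟩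
  have hkF : (k : F) ^ p = k := by
    have := map_intCast (frobenius F p) k
    rwa [frobenius_def] at this
  by_cases hm : m = 0
  · rw [hm, mul_zero, sg, if_pos rfl, ← map_intCast (g.comp C), ← map_pow, hkF]
  · have hpm : p * m ≠ 0 := mul_ne_zero hp.ne_zero hm
    simp only [sg, if_neg hm, if_neg hpm]
    rw [newton_frob F p m (Nat.pos_of_ne_zero hm), mul_pow, ← pow_mul, mul_comm p, map_pow,
      map_pow]

set_option maxHeartbeats 1000000 in
theorem weaklyRegular_main (n : ℕ) (hn : 1 ≤ n) (k : ℤ) (F : Type) [Field F] :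
    RingTheory.Sequence.IsWeaklyRegular (MvPolynomial (Fin n ⊕ ℕ+) F ⧸ IhI F n k)
      (List.ofFn fun m : Fin n => Ideal.Quotient.mk (IhI F n k) (X (Sum.inl m))) := by
  let R := MvPolynomial (Fin n) F
  let P := MvPolynomial (Fin n) R
  let mkA := Ideal.Quotient.mk (IhI F n k)
  let s := sg F n k mkA
  let y : ℕ → P := fun i => if h : i < n then X ⟨i, h⟩ else 0
  let c : ℕ → P := fun j => C (cR F n j)
  let τ : ℕ → P := tau n c y (k : P)
  have hc : c 0 = 1 := by simp [c, cR]
  have hrecP := tau_rec n c y (k : P) hn hc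
  let θ : P →+* MvPolynomial (Fin n ⊕ ℕ+) F ⧸ IhI F n k :=
    eval₂Hom (mkA.comp (rename Sum.inl).toRingHom) (fun i => s i)
  have hθC : ∀ r, θ (C r) = mkA (rename Sum.inl r) := fun r => eval₂Hom_C _ _ _
  have hθX : ∀ i, θ (X i) = s i := fun i => eval₂Hom_X' _ _ _
  have hs0 : s 0 = (k : _) := if_pos rfl
  have hrecA : ∀ i, ∑ j ∈ Finset.range (n + 1), θ (c j) * s (n + i - j) = 0 := by
    intro i
    have h2 : mkA (hRel F n k (n + i)) = 0 :=
      Ideal.Quotient.eq_zero_iff_mem.mpr (Ideal.subset_span ⟨i, rfl⟩)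
    rw [hRel_map] at h2
    rw [← h2]
    refine Finset.sum_congr rfl fun j _ => ?_
    rw [hθC, cvar_eq]
  have hθτ : ∀ m, θ (τ m) = s m := by
    refine tau_map n c y (k : P) hn θ s ?_ ?_ hc hrecA
    · rw [hs0, map_intCast]
    · intro m hm
      simp only [y, dif_pos hm]
      rw [hθX]
  by_cases hchar : ∃ p : ℕ, p.Prime ∧ CharP F p
  · obtain ⟨p, hp, hcp⟩ := hchar
    let I : Ideal P := Ideal.span (Set.range fun m : Fin n => X m ^ p - τ (p * m))
    have hflat : Module.Flat R (P ⧸ I) := by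
      refine flat_quotient (fun m : Fin n => τ (p * m)) hp.pos fun m => ?_
      refine ltDeg_mono hp.two_le (tau_ltDeg n hn _ _ (fun i hi => ?_) k _)
      simp only [y, dif_pos hi]
      have := monomial_mem_ltDeg (R := R) (Finsupp.single (⟨i, hi⟩ : Fin n) 1) 1
      simpa [X] using this
    have hker : ∀ a ∈ I, θ a = 0 := by
      intro a ha
      have : I ≤ RingHom.ker θ := by
        rw [Ideal.span_le]
        rintro _ ⟨m, rfl⟩
        change θ (X m ^ p - τ (p * m)) = 0
        rw [map_sub, map_pow, hθX, hθτ, sub_eq_zero]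
        exact sg_frob F n k p hp mkA m
      exact this ha
    refine weaklyRegular_charP n k F p hp P I τ (tau_zero _ _ _ _) (fun i => hrecP i)
      (fun m hm0 hm => ?_) θ hker hθτ (fun r => hθC r)
    have h1 : τ m = X ⟨m, hm⟩ := by
      simp only [τ]
      rw [tau_lt n c y _ m hm0 hm]
      simp only [y, dif_pos hm]
    rw [h1]
    exact Ideal.subset_span ⟨⟨m, hm⟩, rfl⟩
  · have hflat : Module.Flat R P := inferInstance
    refine weaklyRegular_of_model n k F P τ (tau_zero _ _ _ _) (fun i => hrecP i) ?_ θ hθτ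
      (fun r => hθC r)
    intro p hp hcp
    exact absurd ⟨p, hp, hcp⟩ hchar

theorem top_ne_of_nontrivial {A : Type} [CommRing A] {n : ℕ} (c : Fin n → A)
    (h : Nontrivial (A ⧸ Ideal.span (Set.range c))) :
    (⊤ : Submodule A A) ≠ Ideal.ofList (List.ofFn c) • (⊤ : Submodule A A) := by
  have hJ : Ideal.ofList (List.ofFn c) = Ideal.span (Set.range c) := by
    change Ideal.span {r | r ∈ List.ofFn c} = Ideal.span (Set.range c)
    congr 1
    ext r
    simp [List.mem_ofFn]
  intro htop
  rw [hJ] at htop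
  have h1 : Ideal.span (Set.range c) = ⊤ := by
    rw [eq_comm, htop]
    exact Ideal.mul_top _
  exact Ideal.Quotient.nontrivial_iff.mp h h1

set_option synthInstance.maxHeartbeats 1000000 in
/-- In `A = F[c_1, …, c_n, x_1, x_2, …]/(h_n, h_{n+1}, …)`, the images of `c_1, …, c_n`
form a regular sequence, and `A/(c_1, …, c_n) ≅ F[x_1, x_2, …]/(s_n, s_{n+1}, …)`. -/
theorem cvars_regular_and_quotient_iso (n : ℕ) (hn : 1 ≤ n) (k : ℤ)
    (F : Type) [Field F] :
    letI Ih : Ideal (MvPolynomial (Fin n ⊕ ℕ+) F) :=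
      Ideal.span (Set.range fun j : ℕ => hRel F n k (n + j))
    letI A := MvPolynomial (Fin n ⊕ ℕ+) F ⧸ Ih
    letI c : Fin n → A := fun m => Ideal.Quotient.mk Ih (X (Sum.inl m))
    letI Jc : Ideal A := Ideal.span (Set.range c)
    letI Is : Ideal (MvPolynomial ℕ+ F) :=
      Ideal.span (Set.range fun j : ℕ => newtonPoly F (n + j))
    RingTheory.Sequence.IsRegular A (List.ofFn c) ∧
      ∃ e : (A ⧸ Jc) ≃+* (MvPolynomial ℕ+ F ⧸ Is),
        ∀ i : ℕ+,
          e (Ideal.Quotient.mk Jc (Ideal.Quotient.mk Ih (X (Sum.inr i))))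
            = Ideal.Quotient.mk Is (X i) := by
  obtain ⟨e, he⟩ := quot_iso n hn k F _ rfl _ rfl
  refine ⟨⟨weaklyRegular_main n hn k F, top_ne_of_nontrivial _ ?_⟩, e, he⟩
  have h2 := Ideal.Quotient.nontrivial_iff.mpr (Is_ne_top n F)
  exact e.toEquiv.nontrivial
end

section
/- Fix n ≥ 1, k ∈ ℤ, and a field F. The graded ring A = F[c_1,...,c_n,x_1,x_2,...]/(h_n, h_{n+1}, ...) (with |c_i| = |x_i| = 2i and h_i = k·c_i + Σ_{j=1}^i (-1)^j s_j(x_1,...,x_j)·c_{i-j}) has Poincaré series P_t(A) = P_t(F[x_1,x_2,...]/(s_n, s_{n+1},...)) / ∏_{i=1}^{n} (1 - t^{2i}). -/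
open MvPolynomial

/-- The grading `|c_m| = 2m`, `|x_i| = 2i`. -/
def cxWeight (n : ℕ) : Fin n ⊕ ℕ+ → ℕ :=
  Sum.elim (fun m => 2 * ((m : ℕ) + 1)) (fun i => 2 * (i : ℕ))

/-- The grading `|x_i| = 2i`. -/
def xWeight : ℕ+ → ℕ := fun i => 2 * (i : ℕ)

/-- The degree-`d` part of `A = F[c_1, …, c_n, x_1, x_2, …]/(h_n, h_{n+1}, …)`. -/
noncomputable def pieceA (F : Type) [Field F] (n : ℕ) (k : ℤ) (d : ℕ) :
    Submodule F (MvPolynomial (Fin n ⊕ ℕ+) F ⧸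
      Ideal.span (Set.range fun j : ℕ => hRel F n k (n + j))) :=
  Submodule.map
    (Ideal.Quotient.mkₐ F
      (Ideal.span (Set.range fun j : ℕ => hRel F n k (n + j)))).toLinearMap
    (weightedHomogeneousSubmodule F (cxWeight n) d)

/-- The degree-`d` part of `F[x_1, x_2, …]/(s_n, s_{n+1}, …)`. -/
noncomputable def pieceX (F : Type) [Field F] (n : ℕ) (d : ℕ) :
    Submodule F (MvPolynomial ℕ+ F ⧸
      Ideal.span (Set.range fun j : ℕ => newtonPoly F (n + j))) :=
  Submodule.map
    (Ideal.Quotient.mkₐ F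
      (Ideal.span (Set.range fun j : ℕ => newtonPoly F (n + j)))).toLinearMap
    (weightedHomogeneousSubmodule F xWeight d)

namespace PS

section general
variable {τ : Type} {F : Type} [Field F]

/-- Local factor. -/
noncomputable def fac (e : τ → ℕ) (v g : τ → MvPolynomial τ F) (j : τ) (a : ℕ) : MvPolynomial τ F :=
  g j ^ (a / e j) * v j ^ (a % e j)

theorem fac_zero (e : τ → ℕ) (v g : τ → MvPolynomial τ F) (j : τ) : fac e v g j 0 = 1 := by
  simp [fac]

/-- The linear map sending a monomial to the product of local factors. -/
noncomputable def Psi (e : τ → ℕ) (v g : τ → MvPolynomial τ F) :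
    MvPolynomial τ F →ₗ[F] MvPolynomial τ F :=
  (basisMonomials τ F).constr F (fun m => m.prod (fac e v g))

variable (e : τ → ℕ) (v g : τ → MvPolynomial τ F)

theorem Psi_monomial (m : τ →₀ ℕ) : Psi e v g (monomial m 1) = m.prod (fac e v g) := by
  have := (basisMonomials τ F).constr_basis F (fun m => m.prod (fac e v g)) m
  simpa [Psi] using this

theorem Psi_mul_gen (j : τ) (a : ℕ) (G : MvPolynomial τ F)
    (h : ∀ b, fac e v g j (a + b) = G * fac e v g j b) (y : MvPolynomial τ F) :
    Psi e v g (monomial (Finsupp.single j a) 1 * y) = G * Psi e v g y := by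
  classical
  have : (Psi e v g) ∘ₗ (LinearMap.mulLeft F (monomial (Finsupp.single j a) 1)) =
      (LinearMap.mulLeft F G) ∘ₗ (Psi e v g) := by
    apply (basisMonomials τ F).ext
    intro m
    simp only [coe_basisMonomials, LinearMap.comp_apply, LinearMap.mulLeft_apply, monomial_mul,
      mul_one, Psi_monomial]
    rw [← Finsupp.mul_prod_erase' (Finsupp.single j a + m) j _ (fac_zero e v g),
      ← Finsupp.mul_prod_erase' m j _ (fac_zero e v g)]
    have : (Finsupp.single j a + m).erase j = m.erase j := by
      rw [Finsupp.erase_add]; simp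
    rw [this]
    simp [h, mul_assoc]
  exact LinearMap.congr_fun this y

theorem Psi_g (j : τ) (he : 0 < e j) (y : MvPolynomial τ F) :
    Psi e v g (monomial (Finsupp.single j (e j)) 1 * y) = g j * Psi e v g y := by
  apply Psi_mul_gen
  intro b
  simp [fac, Nat.add_div_left _ he, pow_succ]
  ring

theorem Psi_v (j : τ) (he : e j = 0) (y : MvPolynomial τ F) :
    Psi e v g (X j * y) = v j * Psi e v g y := by
  apply Psi_mul_gen
  intro b
  simp [fac, he]
  ring

theorem Psi_aeval (h : ∀ j, 0 < e j → g j = v j ^ e j) (y : MvPolynomial τ F) :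
    Psi e v g y = aeval v y := by
  have : (Psi e v g) = (aeval v : MvPolynomial τ F →ₐ[F] MvPolynomial τ F).toLinearMap := by
    apply (basisMonomials τ F).ext
    intro m
    simp only [coe_basisMonomials, Psi_monomial, AlgHom.toLinearMap_apply, aeval_monomial, map_one,
      one_mul]
    apply Finsupp.prod_congr
    intro j _
    rcases Nat.eq_zero_or_pos (e j) with h0 | h0
    · simp [fac, h0]
    · rw [fac, h j h0, ← pow_mul, ← pow_add, Nat.div_add_mod]
  rw [this]; rfl

variable (w : τ → ℕ)

theorem Psi_hom_monomial (hv : ∀ j, IsWeightedHomogeneous w (v j) (w j))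
    (hg : ∀ j, 0 < e j → IsWeightedHomogeneous w (g j) (e j * w j)) (m : τ →₀ ℕ) :
    IsWeightedHomogeneous w (Psi e v g (monomial m 1)) (Finsupp.weight w m) := by
  rw [Psi_monomial, Finsupp.weight_apply]
  apply IsWeightedHomogeneous.prod
  intro j _
  rcases Nat.eq_zero_or_pos (e j) with h0 | h0
  · simpa [fac, h0] using (hv j).pow (m j)
  · have := ((hg j h0).pow (m j / e j)).mul ((hv j).pow (m j % e j))
    have h2 : m j • w j = (m j / e j) • (e j * w j) + (m j % e j) • w j := by
      simp only [smul_eq_mul]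
      conv_lhs => rw [← Nat.div_add_mod (m j) (e j)]
      ring
    rw [← h2] at this
    exact this

theorem Psi_comp (hv : ∀ j, IsWeightedHomogeneous w (v j) (w j))
    (hg : ∀ j, 0 < e j → IsWeightedHomogeneous w (g j) (e j * w j)) (d : ℕ)
    (y : MvPolynomial τ F) :
    Psi e v g (weightedHomogeneousComponent w d y) =
      weightedHomogeneousComponent w d (Psi e v g y) := by
  have : (Psi e v g) ∘ₗ (weightedHomogeneousComponent w d) =
      (weightedHomogeneousComponent w d) ∘ₗ (Psi e v g) := by
    apply (basisMonomials τ F).ext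
    intro m
    simp only [coe_basisMonomials, LinearMap.comp_apply]
    rw [weightedHomogeneousComponent_of_mem (n := Finsupp.weight w m)
        (isWeightedHomogeneous_monomial w m 1 rfl),
      weightedHomogeneousComponent_of_mem (Psi_hom_monomial e v g w hv hg m)]
    split_ifs <;> simp
  exact LinearMap.congr_fun this y

theorem finite_weight (hw : ∀ d, {j | w j ≤ d}.Finite) (hpos : ∀ j, 0 < w j) (d : ℕ) :
    {m : τ →₀ ℕ | Finsupp.weight w m = d}.Finite := by
  classical
  refine Set.Finite.subset
    (Finset.finite_toSet (Finset.finsupp (hw d).toFinset (fun _ => Finset.range (d + 1)))) ?_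
  intro m hm
  simp only [Set.mem_ofPred_eq] at hm
  have key : ∀ j, m j * w j ≤ d := by
    intro j
    by_cases hj : j ∈ m.support
    · rw [← hm, Finsupp.weight_apply, Finsupp.sum]
      exact Finset.single_le_sum (f := fun j => m j • w j) (fun _ _ => Nat.zero_le _) hj
    · simp [Finsupp.notMem_support_iff.mp hj]
  simp only [Finset.mem_coe, Finset.mem_finsupp_iff]
  constructor
  · intro j hj
    simp only [Set.Finite.mem_toFinset, Set.mem_ofPred_eq]
    have h1 : 1 ≤ m j := Nat.one_le_iff_ne_zero.mpr (Finsupp.mem_support_iff.mp hj)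
    nlinarith [key j]
  · intro j _
    have := hpos j
    have := key j
    simp only [Finset.mem_range]
    nlinarith

theorem whs_eq (d : ℕ) : weightedHomogeneousSubmodule F w d =
    restrictSupport F {m : τ →₀ ℕ | Finsupp.weight w m = d} :=
  weightedHomogeneousSubmodule_eq_finsupp_supported F w d

theorem Psi_inj (hw : ∀ d, {j | w j ≤ d}.Finite) (hpos : ∀ j, 0 < w j)
    (hv : ∀ j, IsWeightedHomogeneous w (v j) (w j))
    (hg : ∀ j, 0 < e j → IsWeightedHomogeneous w (g j) (e j * w j))
    (hs : Function.Surjective (Psi e v g)) : Function.Injective (Psi e v g) := by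
  rw [← LinearMap.ker_eq_bot, LinearMap.ker_eq_bot']
  intro y hy
  have hmaps : ∀ d, ∀ f ∈ weightedHomogeneousSubmodule F w d,
      Psi e v g f ∈ weightedHomogeneousSubmodule F w d := by
    intro d f hf
    have h1 := Psi_comp e v g w hv hg d f
    rw [weightedHomogeneousComponent_of_mem hf, if_pos rfl] at h1
    rw [h1]
    exact weightedHomogeneousComponent_mem w _ d
  have hcomp : ∀ d, weightedHomogeneousComponent w d y = 0 := by
    intro d
    have : Finite {m : τ →₀ ℕ | Finsupp.weight w m = d} := (finite_weight w hw hpos d).to_subtype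
    have hfin : Module.Finite F (weightedHomogeneousSubmodule F w d) := by
      rw [whs_eq]
      exact Module.Finite.of_basis (basisRestrictSupport F _)
    have hsurj : Function.Surjective ((Psi e v g).restrict (hmaps d)) := by
      rintro ⟨f, hf⟩
      obtain ⟨z, rfl⟩ := hs f
      refine ⟨⟨weightedHomogeneousComponent w d z, weightedHomogeneousComponent_mem w _ d⟩, ?_⟩
      apply Subtype.ext
      simp only [LinearMap.restrict_apply]
      rw [Psi_comp e v g w hv hg, weightedHomogeneousComponent_of_mem hf, if_pos rfl]
    have hinj := LinearMap.injective_iff_surjective.mpr hsurj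
    have := @hinj ⟨weightedHomogeneousComponent w d y, weightedHomogeneousComponent_mem w _ d⟩ 0 (by
      apply Subtype.ext
      simp only [LinearMap.restrict_apply]
      rw [Psi_comp e v g w hv hg, hy]; simp)
    exact congrArg Subtype.val this
  rw [← finsum_weightedHomogeneousComponent w y]
  simp [hcomp]

/-- Standard monomials. -/
def Std : Set (τ →₀ ℕ) := {m | ∀ j, 0 < e j → m j < e j}

theorem span_eq (hs : Function.Surjective (Psi e v g)) :
    (Ideal.span {f | ∃ j, 0 < e j ∧ g j = f}).restrictScalars F =
      (restrictSupport F (Std e)ᶜ).map (Psi e v g) := by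
  apply le_antisymm
  · intro f hf
    have hf' : f ∈ Ideal.span {f | ∃ j, 0 < e j ∧ g j = f} := hf
    clear hf
    refine Submodule.closure_induction
      (p := fun f _ => f ∈ (restrictSupport F (Std e)ᶜ).map (Psi e v g))
      (Submodule.zero_mem _) (fun _ _ _ _ => Submodule.add_mem _) ?_ hf'
    rintro a _ ⟨j, hj, rfl⟩
    obtain ⟨y, rfl⟩ := hs a
    refine ⟨monomial (Finsupp.single j (e j)) 1 * y, ?_, ?_⟩
    · apply (mem_restrictSupport_iff F).mpr
      intro m hm
      simp only [Finset.mem_coe, mem_support_iff] at hm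
      simp only [Std, Set.mem_compl_iff, Set.mem_ofPred_eq, not_forall]
      refine ⟨j, hj, fun hlt => hm ?_⟩
      rw [coeff_monomial_mul', if_neg]
      rw [Finsupp.single_le_iff]; omega
    · rw [Psi_g e v g j hj, smul_eq_mul, mul_comm]
  · rw [Submodule.map_le_iff_le_comap, restrictSupport_eq_span, Submodule.span_le]
    rintro _ ⟨m, hm, rfl⟩
    simp only [Std, Set.mem_compl_iff, Set.mem_ofPred_eq, not_forall, not_lt] at hm
    obtain ⟨j, hj, hmj⟩ := hm
    change Psi e v g (monomial m 1) ∈ Ideal.span {f | ∃ j, 0 < e j ∧ g j = f}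
    have : (monomial m (1:F)) = monomial (Finsupp.single j (e j)) 1 *
        monomial (m - Finsupp.single j (e j)) 1 := by
      rw [monomial_mul, add_tsub_cancel_of_le (by simpa using hmj), one_mul]
    rw [this, Psi_g e v g j hj]
    exact Ideal.mul_mem_right _ _ (Ideal.subset_span ⟨j, hj, rfl⟩)

theorem finrank_piece (hw : ∀ d, {j | w j ≤ d}.Finite) (hpos : ∀ j, 0 < w j)
    (hv : ∀ j, IsWeightedHomogeneous w (v j) (w j))
    (hg : ∀ j, 0 < e j → IsWeightedHomogeneous w (g j) (e j * w j))
    (hs : Function.Surjective (Psi e v g)) (I : Ideal (MvPolynomial τ F))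
    (hI : I = Ideal.span {f | ∃ j, 0 < e j ∧ g j = f}) (d : ℕ) :
    Module.finrank F ((weightedHomogeneousSubmodule F w d).map
      (Ideal.Quotient.mkₐ F I).toLinearMap) =
    Nat.card {m : τ →₀ ℕ | Finsupp.weight w m = d ∧ m ∈ Std e} := by
  classical
  have hinj := Psi_inj e v g w hw hpos hv hg hs
  have hIm : ∀ f, (Ideal.Quotient.mkₐ F I) (Psi e v g f) = 0 ↔ f ∈ restrictSupport F (Std e)ᶜ := by
    intro f
    have h1 := span_eq e v g hs
    rw [← hI] at h1
    rw [Ideal.Quotient.mkₐ_eq_mk, Ideal.Quotient.eq_zero_iff_mem]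
    change Psi e v g f ∈ I.restrictScalars F ↔ _
    rw [h1]
    constructor
    · rintro ⟨f', hf', h⟩
      rwa [← hinj h]
    · intro h
      exact ⟨f, h, rfl⟩
  set S := {m : τ →₀ ℕ | Finsupp.weight w m = d ∧ m ∈ Std e} with hS
  have hmap : (weightedHomogeneousSubmodule F w d).map (Ideal.Quotient.mkₐ F I).toLinearMap =
      (restrictSupport F S).map ((Ideal.Quotient.mkₐ F I).toLinearMap ∘ₗ Psi e v g) := by
    apply le_antisymm
    · rintro _ ⟨f, hf, rfl⟩
      obtain ⟨y, rfl⟩ := hs f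
      have h2 := Psi_comp e v g w hv hg d y
      rw [weightedHomogeneousComponent_of_mem hf, if_pos rfl] at h2
      rw [← h2]
      have h3 : weightedHomogeneousComponent w d y ∈
        restrictSupport F {m : τ →₀ ℕ | Finsupp.weight w m = d} := by
        rw [← whs_eq]; exact weightedHomogeneousComponent_mem w _ d
      generalize weightedHomogeneousComponent w d y = z at h3
      rw [restrictSupport_eq_span] at h3
      clear h2 hf
      refine Submodule.span_induction (p := fun z _ => (Ideal.Quotient.mkₐ F I).toLinearMap
        (Psi e v g z) ∈ (restrictSupport F S).map
          ((Ideal.Quotient.mkₐ F I).toLinearMap ∘ₗ Psi e v g)) ?_ (by simp) ?_ ?_ h3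
      · rintro _ ⟨m, hm, rfl⟩
        by_cases hst : m ∈ Std e
        · exact ⟨monomial m 1, (monomial_mem_restrictSupport F).mpr (Or.inl ⟨hm, hst⟩), rfl⟩
        · have : (Ideal.Quotient.mkₐ F I) (Psi e v g (monomial m 1)) = 0 :=
            (hIm _).mpr ((monomial_mem_restrictSupport F).mpr (Or.inl hst))
          rw [AlgHom.toLinearMap_apply, this]
          exact Submodule.zero_mem _
      · intro a b _ _ ha hb
        rw [map_add, map_add]; exact Submodule.add_mem _ ha hb
      · intro a b _ hb
        rw [map_smul, map_smul]; exact Submodule.smul_mem _ _ hb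
    · rintro _ ⟨f, hf, rfl⟩
      refine ⟨Psi e v g f, ?_, rfl⟩
      have hf' : f ∈ weightedHomogeneousSubmodule F w d := by
        rw [whs_eq]
        exact restrictSupport_mono F (fun m hm => hm.1) hf
      have h1 := Psi_comp e v g w hv hg d f
      rw [weightedHomogeneousComponent_of_mem hf', if_pos rfl] at h1
      rw [h1]
      exact weightedHomogeneousComponent_mem w _ d
  rw [hmap]
  have hi : Function.Injective (((Ideal.Quotient.mkₐ F I).toLinearMap ∘ₗ Psi e v g).domRestrict
      (restrictSupport F S)) := by
    rw [← LinearMap.ker_eq_bot, LinearMap.ker_eq_bot']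
    rintro ⟨f, hf⟩ h
    have h1 : f ∈ restrictSupport F (Std e)ᶜ := (hIm f).mp h
    apply Subtype.ext
    change f = 0
    rw [← support_eq_empty, Finset.eq_empty_iff_forall_notMem]
    intro m hm
    exact ((mem_restrictSupport_iff F).mp h1 hm) ((mem_restrictSupport_iff F).mp hf hm).2
  have hr : (restrictSupport F S).map ((Ideal.Quotient.mkₐ F I).toLinearMap ∘ₗ Psi e v g) =
      LinearMap.range (((Ideal.Quotient.mkₐ F I).toLinearMap ∘ₗ Psi e v g).domRestrict
      (restrictSupport F S)) := by
    rw [LinearMap.range_domRestrict]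
  rw [hr, LinearMap.finrank_range_of_inj hi]
  exact Module.finrank_eq_nat_card_basis (basisRestrictSupport F S)

end general

section newton
variable (F : Type) [Field F]

theorem newton_succ (i : ℕ) : newtonPoly F (i + 1) =
    (∑ j ∈ Finset.range i,
        (-1 : MvPolynomial ℕ+ F) ^ j * X (Nat.succPNat j) *
          newtonPoly F (i - j))
      + (-1) ^ i * ((i : MvPolynomial ℕ+ F) + 1) *
        X (Nat.succPNat i) := by
  rw [newtonPoly]; rfl

theorem newton_psum (M : ℕ) (i : ℕ) :
    aeval (fun j : ℕ+ => esymm (Fin M) F j) (newtonPoly F (i + 1)) = psum (Fin M) F (i + 1) := by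
  induction i using Nat.strong_induction_on with
  | _ i ih =>
    rw [newton_succ, psum_eq_mul_esymm_sub_sum (Fin M) F (i + 1) (by omega)]
    have hsum : ∑ a ∈ Finset.HasAntidiagonal.antidiagonal (i + 1) with a.1 ∈ Set.Ioo 0 (i + 1),
        (-1 : MvPolynomial (Fin M) F) ^ a.1 * esymm (Fin M) F a.1 * psum (Fin M) F a.2 =
        ∑ j ∈ Finset.range i, (-1 : MvPolynomial (Fin M) F) ^ (j + 1) * esymm (Fin M) F (j + 1) *
          psum (Fin M) F (i - j) := by
      refine Finset.sum_nbij' (fun a => a.1 - 1) (fun j => (j + 1, i - j)) ?_ ?_ ?_ ?_ ?_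
      · rintro ⟨a, b⟩ h
        simp at h ⊢; omega
      · intro j h
        simp at h ⊢; omega
      · rintro ⟨a, b⟩ h
        simp at h ⊢; omega
      · intro j h
        simp
      · rintro ⟨a, b⟩ h
        simp at h
        obtain ⟨h1, h2, h3⟩ := h
        have e1 : a - 1 + 1 = a := by omega
        have e2 : i - (a - 1) = b := by omega
        simp only [e1, e2]
    rw [hsum]
    have hl : aeval (fun j : ℕ+ => esymm (Fin M) F j) (∑ j ∈ Finset.range i,
        (-1 : MvPolynomial ℕ+ F) ^ j * X (Nat.succPNat j) *
          newtonPoly F (i - j)) = - ∑ j ∈ Finset.range i, (-1 : MvPolynomial (Fin M) F) ^ (j + 1) *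
            esymm (Fin M) F (j + 1) * psum (Fin M) F (i - j) := by
      rw [map_sum, ← Finset.sum_neg_distrib]
      refine Finset.sum_congr rfl fun j hj => ?_
      have hj' := Finset.mem_range.mp hj
      have := ih (i - j - 1) (by omega)
      rw [show i - j - 1 + 1 = i - j by omega] at this
      simp only [map_mul, map_pow, map_neg, map_one, aeval_X, this, Nat.succPNat_coe, Nat.succ_eq_add_one]
      ring
    rw [map_add, hl]
    simp only [map_mul, map_pow, map_neg, map_one, aeval_X, Nat.succPNat_coe, Nat.succ_eq_add_one, map_add, map_natCast]
    push_cast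
    ring

theorem newton_frob (p : ℕ) [hp : Fact p.Prime] [CharP F p] (j : ℕ) :
    newtonPoly F (p * j) = newtonPoly F j ^ p := by
  rcases j with _ | j
  · simp [newtonPoly, hp.out.ne_zero]
  rw [← sub_eq_zero]
  set f := newtonPoly F (p * (j + 1)) - newtonPoly F (j + 1) ^ p with hf
  obtain ⟨M, hM⟩ : ∃ M : ℕ, ∀ i ∈ f.vars, (i : ℕ) ≤ M :=
    ⟨f.vars.sup (fun i => (i : ℕ)), fun i hi => Finset.le_sup (f := fun i : ℕ+ => (i : ℕ)) hi⟩
  obtain ⟨q, hq⟩ := exists_rename_eq_of_vars_subset_range f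
    (fun i : Fin M => Nat.succPNat i)
    (fun a b h => by
      have := congrArg PNat.val h
      simp at this
      exact Fin.ext this)
    (fun i hi => by
      have := hM i hi
      have h2 := i.pos
      exact ⟨⟨i - 1, by omega⟩, PNat.eq (by simp; omega)⟩)
  have h0 : aeval (fun j : ℕ+ => esymm (Fin M) F j) f = 0 := by
    have hpos : 0 < p * (j + 1) := Nat.mul_pos hp.out.pos (Nat.succ_pos _)
    have h1 := newton_psum F M (p * (j + 1) - 1)
    rw [Nat.sub_add_cancel hpos] at h1
    rw [hf, map_sub, map_pow, h1, newton_psum, sub_eq_zero]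
    simp only [psum]
    rw [sum_pow_char]
    refine Finset.sum_congr rfl fun i _ => ?_
    rw [← pow_mul, mul_comm]
  rw [← hq, aeval_rename] at h0
  have h2 : esymmAlgHom (Fin M) F M q = 0 := by
    apply Subtype.ext
    rw [esymmAlgHom_apply]
    exact h0
  have h3 : q = 0 := by
    have hi := esymmAlgHom_injective (σ := Fin M) (R := F) (n := M) (by simp)
    exact hi (by rw [h2, map_zero])
  rw [← hq, h3, map_zero]

/-- Signed Newton polynomials. -/
noncomputable def sN (i : ℕ) : MvPolynomial ℕ+ F := (-1) ^ i * newtonPoly F i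

theorem sN_frob (p : ℕ) [hp : Fact p.Prime] [CharP F p] (j : ℕ) :
    sN F (p * j) = sN F j ^ p := by
  rw [sN, sN, newton_frob, mul_pow, ← pow_mul, mul_comm j p]

theorem sN_frob_pow (p : ℕ) [hp : Fact p.Prime] [CharP F p] (j a : ℕ) :
    sN F (j * p ^ a) = sN F j ^ p ^ a := by
  induction a with
  | zero => simp
  | succ a ih => rw [pow_succ, ← mul_assoc, mul_comm, sN_frob, ih, pow_mul]

theorem newton_hom (i : ℕ) : IsWeightedHomogeneous xWeight (newtonPoly F i) (2 * i) := by
  induction i using Nat.strong_induction_on with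
  | _ i ih =>
    rcases i with _ | i
    · rw [newtonPoly]; exact isWeightedHomogeneous_zero _ _ _
    rw [newton_succ]
    have hsgn : ∀ j : ℕ, (-1 : MvPolynomial ℕ+ F) ^ j = C ((-1) ^ j) := by intro j; simp
    apply IsWeightedHomogeneous.add
    · apply IsWeightedHomogeneous.sum
      intro j hj
      have hj' := Finset.mem_range.mp hj
      rw [hsgn, mul_assoc]
      apply IsWeightedHomogeneous.C_mul
      have := (isWeightedHomogeneous_X F xWeight (Nat.succPNat j)).mul (ih (i - j) (by omega))
      rw [show xWeight (Nat.succPNat j) + 2 * (i - j) = 2 * (i + 1) by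
        change 2 * (j + 1) + 2 * (i - j) = 2 * (i + 1)
        omega] at this
      exact this
    · rw [show ((-1) ^ i * ((i : MvPolynomial ℕ+ F) + 1)) = C ((-1) ^ i * ((i : F) + 1)) by simp]
      exact (isWeightedHomogeneous_X F xWeight (Nat.succPNat i)).C_mul _

theorem newton_mem (R : Subalgebra F (MvPolynomial ℕ+ F)) (i : ℕ)
    (h : ∀ j : ℕ+, (j : ℕ) ≤ i → X j ∈ R) : newtonPoly F i ∈ R := by
  induction i using Nat.strong_induction_on with
  | _ i ih =>
    rcases i with _ | i
    · rw [newtonPoly]; exact R.zero_mem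
    rw [newton_succ]
    refine R.add_mem (R.sum_mem fun j hj => ?_) ?_
    · have hj' := Finset.mem_range.mp hj
      refine R.mul_mem (R.mul_mem (R.pow_mem (R.neg_mem R.one_mem) _) (h _ (by simp; omega)))
        (ih _ (by omega) fun l hl => h l (by omega))
    · refine R.mul_mem (R.mul_mem (R.pow_mem (R.neg_mem R.one_mem) _) ?_) (h _ (by simp))
      exact R.add_mem (natCast_mem R i) R.one_mem

end newton

section hrec

theorem h_rec {Q : Type} [CommRing Q] (p : ℕ) [hp : Fact p.Prime] [CharP Q p] (n : ℕ)
    (T c h : ℕ → Q) (hT : ∀ a, T (p * a) = T a ^ p) (c0 : c 0 = 1) (hc : ∀ m, n < m → c m = 0)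
    (hh : ∀ i, h i = ∑ x ∈ Finset.HasAntidiagonal.antidiagonal i, T x.1 * c x.2) (j : ℕ) (hj1 : 1 ≤ j)
    (hj : n ≤ j) :
    h (p * j) ∈ Ideal.span {f | ∃ i, n ≤ i ∧ i < p * j ∧ h i = f} := by
  classical
  have hp2 := hp.out.two_le
  let Cp : Polynomial Q := ∑ i ∈ Finset.range (n + 1), Polynomial.monomial i (c i)
  have hCp : ∀ i, Cp.coeff i = c i := by
    intro i
    simp only [Cp, Polynomial.finsetSum_coeff, Polynomial.coeff_monomial]
    rw [Finset.sum_ite_eq']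
    split_ifs with h1
    · rfl
    · exact (hc i (by simpa using h1)).symm
  have hdeg : Cp.natDegree ≤ n := by
    apply Polynomial.natDegree_le_iff_coeff_eq_zero.mpr
    intro N hN
    rw [hCp, hc N hN]
  clear_value Cp
  let Tp : PowerSeries Q := PowerSeries.mk T
  have hH : Tp * (Cp : PowerSeries Q) = PowerSeries.mk h := by
    ext i
    rw [PowerSeries.coeff_mul, PowerSeries.coeff_mk, hh]
    simp [Tp, hCp]
  have hH2 : PowerSeries.mk h * ((Cp ^ (p - 1) : Polynomial Q) : PowerSeries Q) =
      Tp * ((Cp ^ p : Polynomial Q) : PowerSeries Q) := by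
    rw [← hH, mul_assoc, ← Polynomial.coe_mul, ← pow_succ', Nat.sub_add_cancel (by omega)]
  have hco := congrArg (PowerSeries.coeff (p * j)) hH2
  rw [PowerSeries.coeff_mul, PowerSeries.coeff_mul] at hco
  have hR : ∑ x ∈ Finset.HasAntidiagonal.antidiagonal (p * j), (PowerSeries.coeff x.1) Tp *
      (PowerSeries.coeff x.2) ((Cp ^ p : Polynomial Q) : PowerSeries Q) = h j ^ p := by
    rw [hh, sum_pow_char]
    symm
    apply Finset.sum_of_injOn (fun x : ℕ × ℕ => (p * x.1, p * x.2))
    · rintro ⟨a, b⟩ _ ⟨a', b'⟩ _ hab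
      simp [hp.out.ne_zero] at hab ⊢
      exact hab
    · rintro ⟨a, b⟩ hab
      simp at hab ⊢
      rw [← mul_add, hab]
    · rintro ⟨a, b⟩ hab hnot
      simp only [Polynomial.coeff_coe]
      rw [← Polynomial.map_frobenius_expand p, Polynomial.coeff_map,
        Polynomial.coeff_expand hp.out.pos]
      split_ifs with hd
      · exfalso
        obtain ⟨b', rfl⟩ := hd
        simp at hab
        have : p ∣ a := by
          have : a = p * j - p * b' := by omega
          rw [this, ← Nat.mul_sub]; exact dvd_mul_right _ _
        obtain ⟨a', rfl⟩ := this
        apply hnot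
        refine ⟨(a', b'), ?_, rfl⟩
        simp
        rw [← mul_add] at hab
        exact Nat.eq_of_mul_eq_mul_left hp.out.pos hab
      · simp [frobenius_def, hp.out.ne_zero]
    · rintro ⟨a, b⟩ hab
      simp only [Polynomial.coeff_coe]
      rw [← Polynomial.map_frobenius_expand p, Polynomial.coeff_map,
        Polynomial.coeff_expand_mul' hp.out.pos, frobenius_def, hCp]
      simp [Tp, hT, mul_pow]
  rw [hR] at hco
  have hmem : (p * j, 0) ∈ Finset.HasAntidiagonal.antidiagonal (p * j) := by simp
  rw [← Finset.add_sum_erase _ _ hmem] at hco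
  have h0 : (PowerSeries.coeff 0) ((Cp ^ (p - 1) : Polynomial Q) : PowerSeries Q) = 1 := by
    rw [Polynomial.coeff_coe, Polynomial.coeff_zero_eq_eval_zero, Polynomial.eval_pow,
      ← Polynomial.coeff_zero_eq_eval_zero, hCp, c0, one_pow]
  simp only [h0, mul_one, PowerSeries.coeff_mk] at hco
  rw [eq_sub_of_add_eq hco]
  apply Ideal.sub_mem
  · have hlt : j < p * j := by nlinarith
    have hm : h j ∈ Ideal.span {f | ∃ i, n ≤ i ∧ i < p * j ∧ h i = f} :=
      Ideal.subset_span ⟨j, hj, hlt, rfl⟩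
    exact Ideal.pow_mem_of_mem _ hm _ hp.out.pos
  · apply Ideal.sum_mem
    rintro ⟨a, b⟩ hab
    simp only [Finset.mem_erase, Finset.HasAntidiagonal.mem_antidiagonal, ne_eq, Prod.mk.injEq] at hab
    by_cases ha : n ≤ a
    · exact Ideal.mul_mem_right _ _ (Ideal.subset_span ⟨a, ha, by omega, rfl⟩)
    · have : (Cp ^ (p - 1)).coeff b = 0 := by
        apply Polynomial.coeff_eq_zero_of_natDegree_lt
        have h1 := Polynomial.natDegree_pow_le_of_le (p - 1) hdeg
        refine lt_of_le_of_lt h1 ?_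
        obtain ⟨q, rfl⟩ : ∃ q, p = q + 1 := ⟨p - 1, by omega⟩
        simp only [Nat.add_sub_cancel]
        have h3 : q * n ≤ q * j := Nat.mul_le_mul_left _ hj
        have h4 : (q + 1) * j = q * j + j := by ring
        omega
      rw [Polynomial.coeff_coe, this, mul_zero]
      exact Ideal.zero_mem _

end hrec

section count

theorem count_step {τ : Type} (w : τ → ℕ) (hw : ∀ d, {j | w j ≤ d}.Finite) (hpos : ∀ j, 0 < w j)
    (j : τ) (Z Z' : Set (τ →₀ ℕ)) (h1 : ∀ m, m ∈ Z' ↔ m ∈ Z ∧ m j = 0)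
    (h2 : ∀ m, Finsupp.single j 1 + m ∈ Z ↔ m ∈ Z) :
    (PowerSeries.mk fun d => (Nat.card {m : τ →₀ ℕ | Finsupp.weight w m = d ∧ m ∈ Z} : ℤ)) *
      (1 - (PowerSeries.X : PowerSeries ℤ) ^ (w j)) =
    PowerSeries.mk fun d => (Nat.card {m : τ →₀ ℕ | Finsupp.weight w m = d ∧ m ∈ Z'} : ℤ) := by
  classical
  ext d
  rw [mul_sub, mul_one, map_sub, PowerSeries.coeff_mul_X_pow']
  simp only [PowerSeries.coeff_mk, Nat.card_coe_set_eq]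
  have hfin : ∀ (Y : Set (τ →₀ ℕ)) d, {m : τ →₀ ℕ | Finsupp.weight w m = d ∧ m ∈ Y}.Finite :=
    fun Y d => (finite_weight w hw hpos d).subset fun m hm => hm.1
  have hwt : ∀ m : τ →₀ ℕ, Finsupp.weight w (Finsupp.single j 1 + m) = w j + Finsupp.weight w m := by
    intro m; rw [map_add, Finsupp.weight_single, one_smul]
  have hle : ∀ m : τ →₀ ℕ, m j ≠ 0 → ∃ m', m = Finsupp.single j 1 + m' := fun m hm =>
    ⟨m - Finsupp.single j 1, (add_tsub_cancel_of_le (by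
      rw [Finsupp.single_le_iff]; omega)).symm⟩
  split_ifs with hd
  · have hunion : {m : τ →₀ ℕ | Finsupp.weight w m = d ∧ m ∈ Z} =
        {m : τ →₀ ℕ | Finsupp.weight w m = d ∧ m ∈ Z'} ∪
        (fun m => Finsupp.single j 1 + m) ''
          {m : τ →₀ ℕ | Finsupp.weight w m = d - w j ∧ m ∈ Z} := by
      ext m
      constructor
      · rintro ⟨ha, hb⟩
        by_cases hm : m j = 0
        · exact Or.inl ⟨ha, (h1 m).mpr ⟨hb, hm⟩⟩
        · obtain ⟨m', rfl⟩ := hle m hm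
          rw [hwt] at ha
          exact Or.inr ⟨m', ⟨by omega, (h2 m').mp hb⟩, rfl⟩
      · rintro (⟨ha, hb⟩ | ⟨m', ⟨ha, hb⟩, rfl⟩)
        · exact ⟨ha, ((h1 m).mp hb).1⟩
        · exact ⟨by rw [hwt]; omega, (h2 m').mpr hb⟩
    rw [hunion, Set.ncard_union_eq ?_ (hfin _ _) ((hfin _ _).image _),
      Set.ncard_image_of_injective _ (add_right_injective _)]
    · push_cast; ring
    · rw [Set.disjoint_left]
      rintro _ ⟨_, hb⟩ ⟨m', _, rfl⟩
      have := ((h1 _).mp hb).2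
      simp at this
  · rw [sub_zero]
    congr 2
    ext m
    constructor
    · rintro ⟨ha, hb⟩
      refine ⟨ha, (h1 m).mpr ⟨hb, ?_⟩⟩
      by_contra hm
      obtain ⟨m', rfl⟩ := hle m hm
      rw [hwt] at ha
      omega
    · rintro ⟨ha, hb⟩
      exact ⟨ha, ((h1 m).mp hb).1⟩

theorem xW_fin (d : ℕ) : {j | xWeight j ≤ d}.Finite := by
  refine Set.Finite.subset ((Set.finite_Iic d).preimage (f := fun j : ℕ+ => (j : ℕ))
    PNat.coe_injective.injOn) ?_
  intro j hj
  have : 2 * (j : ℕ) ≤ d := hj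
  change (j : ℕ) ≤ d
  omega

theorem xW_pos (j : ℕ+) : 0 < xWeight j := by
  have := j.pos
  change 0 < 2 * (j : ℕ)
  omega

theorem cxW_fin (n d : ℕ) : {j | cxWeight n j ≤ d}.Finite := by
  refine Set.Finite.subset ((Set.toFinite (Set.range (Sum.inl : Fin n → Fin n ⊕ ℕ+))).union
    ((xW_fin d).image Sum.inr)) ?_
  rintro (i | j) hj
  · exact Or.inl ⟨i, rfl⟩
  · exact Or.inr ⟨j, hj, rfl⟩

theorem cxW_pos (n : ℕ) (j : Fin n ⊕ ℕ+) : 0 < cxWeight n j := by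
  rcases j with i | j
  · change 0 < 2 * ((i : ℕ) + 1)
    omega
  · exact xW_pos j

theorem weight_inr (n : ℕ) (m : ℕ+ →₀ ℕ) :
    Finsupp.weight (cxWeight n) (m.mapDomain Sum.inr) = Finsupp.weight xWeight m := by
  rw [Finsupp.weight_apply, Finsupp.weight_apply,
    Finsupp.sum_mapDomain_index_inj Sum.inr_injective]
  rfl

theorem exists_mapDomain (n : ℕ) (m : (Fin n ⊕ ℕ+) →₀ ℕ) (h : ∀ i, m (Sum.inl i) = 0) :
    ∃ m' : ℕ+ →₀ ℕ, m = m'.mapDomain Sum.inr := by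
  refine ⟨m.comapDomain Sum.inr Sum.inr_injective.injOn, ?_⟩
  rw [Finsupp.mapDomain_comapDomain _ Sum.inr_injective]
  rintro (i | j) hj
  · simp [h i] at hj
  · exact ⟨j, rfl⟩

theorem count_all (n : ℕ) (e : ℕ+ → ℕ) :
    (PowerSeries.mk fun d => (Nat.card {m : (Fin n ⊕ ℕ+) →₀ ℕ |
        Finsupp.weight (cxWeight n) m = d ∧ m ∈ Std (Sum.elim (fun _ => 0) e)} : ℤ)) *
        ∏ i ∈ Finset.range n, (1 - (PowerSeries.X : PowerSeries ℤ) ^ (2 * (i + 1))) =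
    PowerSeries.mk fun d => (Nat.card {m : ℕ+ →₀ ℕ |
        Finsupp.weight xWeight m = d ∧ m ∈ Std e} : ℤ) := by
  classical
  let Z : ℕ → Set ((Fin n ⊕ ℕ+) →₀ ℕ) := fun r =>
    {m | m ∈ Std (Sum.elim (fun _ => 0) e) ∧ ∀ i : Fin n, r ≤ i → m (Sum.inl i) = 0}
  have key : ∀ r, r ≤ n → (PowerSeries.mk fun d => (Nat.card {m : (Fin n ⊕ ℕ+) →₀ ℕ |
        Finsupp.weight (cxWeight n) m = d ∧ m ∈ Z r} : ℤ)) *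
        ∏ i ∈ Finset.range r, (1 - (PowerSeries.X : PowerSeries ℤ) ^ (2 * (i + 1))) =
      PowerSeries.mk fun d => (Nat.card {m : (Fin n ⊕ ℕ+) →₀ ℕ |
        Finsupp.weight (cxWeight n) m = d ∧ m ∈ Z 0} : ℤ) := by
    intro r
    induction r with
    | zero => intro _; simp
    | succ r ih =>
      intro hr
      have hst := count_step (cxWeight n) (cxW_fin n) (cxW_pos n) (Sum.inl ⟨r, hr⟩) (Z (r + 1)) (Z r)
        (by
          intro m
          constructor
          · rintro ⟨ha, hb⟩
            exact ⟨⟨ha, fun i hi => hb i (by omega)⟩, hb ⟨r, hr⟩ le_rfl⟩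
          · rintro ⟨⟨ha, hb⟩, hc⟩
            refine ⟨ha, fun i hi => ?_⟩
            rcases Nat.eq_or_lt_of_le hi with h | h
            · have : i = ⟨r, hr⟩ := Fin.ext h.symm
              rw [this]; exact hc
            · exact hb i h)
        (by
          intro m
          refine and_congr ?_ ?_
          · apply forall_congr'
            rintro (i | j)
            · simp
            · simp [Finsupp.single_apply]
          · apply forall_congr'
            intro i
            apply imp_congr_right
            intro hi
            have : Sum.inl (β := ℕ+) (⟨r, hr⟩ : Fin n) ≠ Sum.inl i := by
              intro h
              have := congrArg Fin.val (Sum.inl_injective h)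
              simp at this
              omega
            simp [Finsupp.single_apply, this])
      rw [Finset.prod_range_succ, mul_comm (∏ i ∈ Finset.range r, _), ← mul_assoc]
      have hwr : cxWeight n (Sum.inl ⟨r, hr⟩) = 2 * (r + 1) := rfl
      rw [hwr] at hst
      rw [hst, ih (by omega)]
  have hZn : Z n = Std (Sum.elim (fun _ => 0) e) := by
    ext m
    constructor
    · exact fun h => h.1
    · exact fun h => ⟨h, fun i hi => absurd i.2 (by omega)⟩
  have := key n le_rfl
  rw [hZn] at this
  rw [this]
  congr 1
  ext d
  simp only [Nat.card_coe_set_eq]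
  have himg : {m : (Fin n ⊕ ℕ+) →₀ ℕ | Finsupp.weight (cxWeight n) m = d ∧ m ∈ Z 0} =
      (Finsupp.mapDomain Sum.inr) '' {m : ℕ+ →₀ ℕ | Finsupp.weight xWeight m = d ∧ m ∈ Std e} := by
    ext m
    constructor
    · rintro ⟨ha, hb, hc⟩
      obtain ⟨m', rfl⟩ := exists_mapDomain n m (fun i => hc i (Nat.zero_le _))
      refine ⟨m', ⟨by rw [← weight_inr n]; exact ha, fun j hj => ?_⟩, rfl⟩
      have := hb (Sum.inr j) hj
      rwa [Finsupp.mapDomain_apply Sum.inr_injective] at this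
    · rintro ⟨m', ⟨ha, hb⟩, rfl⟩
      have hl : ∀ i : Fin n, (m'.mapDomain Sum.inr : (Fin n ⊕ ℕ+) →₀ ℕ) (Sum.inl i) = 0 := by
        intro i
        apply Finsupp.mapDomain_of_notMem_range
        simp
      refine ⟨by rw [weight_inr]; exact ha, ?_, fun i _ => hl i⟩
      rintro (i | j) hj
      · simp at hj
      · rw [Finsupp.mapDomain_apply Sum.inr_injective]
        exact hb j hj
  rw [himg, Set.ncard_image_of_injective _ (Finsupp.mapDomain_injective Sum.inr_injective)]

end count

section ideals

open Classical in
/-- Exponent of the basic relation attached to the index `j`. -/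
noncomputable def eX (p n : ℕ) (j : ℕ+) : ℕ :=
  if p ∣ (j : ℕ) then 0 else if h : ∃ a, n ≤ (j : ℕ) * p ^ a then p ^ Nat.find h else 0

theorem eX_spec (p n : ℕ) (j : ℕ+) (h : 0 < eX p n j) :
    ¬ p ∣ (j : ℕ) ∧ n ≤ (j : ℕ) * eX p n j ∧ ∃ a, eX p n j = p ^ a := by
  classical
  unfold eX at h ⊢
  split_ifs at h ⊢ with h1 h2
  · omega
  · exact ⟨h1, Nat.find_spec h2, _, rfl⟩
  · omega

theorem eX_cover (p n i : ℕ) (hp : p.Prime ∨ p = 0) (hi : 1 ≤ i) (hn : n ≤ i)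
    (hni : ¬ ∃ j, i = p * j ∧ n ≤ j) : ∃ j : ℕ+, 0 < eX p n j ∧ (j : ℕ) * eX p n j = i := by
  classical
  rcases hp with hp | rfl
  · obtain ⟨a, j, hj, rfl⟩ := Nat.exists_eq_pow_mul_and_not_dvd (by omega : i ≠ 0) p hp.ne_one
    have hj0 : 0 < j := Nat.pos_of_ne_zero fun h => hj (by simp [h])
    obtain ⟨J, rfl⟩ : ∃ J : ℕ+, (J : ℕ) = j := ⟨⟨j, hj0⟩, rfl⟩
    refine ⟨J, ?_⟩
    have hex : ∃ b, n ≤ (J : ℕ) * p ^ b := ⟨a, by rwa [mul_comm]⟩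
    have hfind : Nat.find hex = a := by
      rw [Nat.find_eq_iff]
      refine ⟨by rwa [mul_comm], fun b hb hle => hni ?_⟩
      refine ⟨(J : ℕ) * p ^ (a - 1), ?_, hle.trans ?_⟩
      · obtain ⟨a', rfl⟩ : ∃ a', a = a' + 1 := ⟨a - 1, by omega⟩
        simp only [Nat.add_sub_cancel]
        ring
      · exact Nat.mul_le_mul_left _ (Nat.pow_le_pow_right hp.pos (by omega))
    have : eX p n J = p ^ a := by
      unfold eX
      rw [if_neg hj, dif_pos hex, hfind]
    rw [this]
    exact ⟨pow_pos hp.pos a, mul_comm _ _⟩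
  · obtain ⟨J, rfl⟩ : ∃ J : ℕ+, (J : ℕ) = i := ⟨⟨i, hi⟩, rfl⟩
    refine ⟨J, ?_⟩
    have hex : ∃ b, n ≤ (J : ℕ) * 0 ^ b := ⟨0, by simpa using hn⟩
    have hfind : Nat.find hex = 0 := by
      rw [Nat.find_eq_zero]; simpa using hn
    have : eX 0 n J = 1 := by
      unfold eX
      rw [if_neg (by rw [zero_dvd_iff]; omega), dif_pos hex, hfind, pow_zero]
    rw [this]
    simp

theorem ideal_eq {Q : Type} [CommRing Q] (p n : ℕ) (hp : p.Prime ∨ p = 0) (hn : 1 ≤ n) (h : ℕ → Q)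
    (hrec : p.Prime → ∀ j, n ≤ j →
      h (p * j) ∈ Ideal.span {f | ∃ i, n ≤ i ∧ i < p * j ∧ h i = f}) :
    Ideal.span (Set.range fun j : ℕ => h (n + j)) =
      Ideal.span {f | ∃ j : ℕ+, 0 < eX p n j ∧ h (j * eX p n j) = f} := by
  apply le_antisymm
  · rw [Ideal.span_le]
    rintro _ ⟨j, rfl⟩
    have : ∀ i, n ≤ i → h i ∈ Ideal.span {f | ∃ j : ℕ+, 0 < eX p n j ∧ h (j * eX p n j) = f} := by
      intro i
      induction i using Nat.strong_induction_on with
      | _ i ih =>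
        intro hi
        by_cases hc : ∃ j, i = p * j ∧ n ≤ j
        · obtain ⟨j, rfl, hj⟩ := hc
          have hpp : p.Prime := by
            rcases hp with hp | rfl
            · exact hp
            · simp at hi; omega
          refine (Ideal.span_le.mpr ?_) (hrec hpp j hj)
          rintro _ ⟨i, h1, h2, rfl⟩
          exact ih i h2 h1
        · obtain ⟨j, hj, hji⟩ := eX_cover p n i hp (by omega) hi hc
          exact Ideal.subset_span ⟨j, hj, by rw [hji]⟩
    exact this _ (by omega)
  · rw [Ideal.span_le]
    rintro _ ⟨j, hj, rfl⟩
    have := (eX_spec p n j hj).2.1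
    exact Ideal.subset_span ⟨j * eX p n j - n, by
      change h (n + (j * eX p n j - n)) = _
      rw [Nat.add_sub_cancel' this]⟩

end ideals

section xcase
variable (F : Type) [Field F]

theorem char_cases : (ringChar F).Prime ∨ ringChar F = 0 := CharP.char_is_prime_or_zero F _

open Classical in
/-- The new coordinates. -/
noncomputable def vX (j : ℕ+) : MvPolynomial ℕ+ F :=
  if ringChar F ∣ (j : ℕ) then X j else sN F j

/-- The exponents. -/
noncomputable def eF (n : ℕ) (j : ℕ+) : ℕ := eX (ringChar F) n j

theorem sN_hom (i : ℕ) : IsWeightedHomogeneous xWeight (sN F i) (2 * i) := by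
  rw [sN, show (-1 : MvPolynomial ℕ+ F) ^ i = C ((-1) ^ i) by simp]
  exact (newton_hom F i).C_mul _

theorem vX_hom (j : ℕ+) : IsWeightedHomogeneous xWeight (vX F j) (xWeight j) := by
  unfold vX
  split_ifs
  · exact isWeightedHomogeneous_X F xWeight j
  · exact sN_hom F j

theorem sN_eq_pow (n : ℕ) (j : ℕ+) (h : 0 < eF F n j) : sN F (j * eF F n j) = vX F j ^ eF F n j := by
  unfold eF at *
  obtain ⟨h1, -, a, ha⟩ := eX_spec _ _ _ h
  rw [vX, if_neg h1, ha]
  rcases char_cases F with hp | hp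
  · haveI : Fact (ringChar F).Prime := ⟨hp⟩
    exact sN_frob_pow F (ringChar F) j a
  · rw [ha, hp] at h
    rw [hp]
    rcases a with _ | a
    · simp
    · simp at h

theorem vX_surj : Function.Surjective (aeval (R := F) (vX F)) := by
  have hX : ∀ m : ℕ, ∀ j : ℕ+, (j : ℕ) = m → X j ∈ (aeval (R := F) (vX F)).range := by
    intro m
    induction m using Nat.strong_induction_on with
    | _ m ih =>
      intro j hj
      have hv : vX F j ∈ (aeval (R := F) (vX F)).range := ⟨X j, by simp⟩
      by_cases hd : ringChar F ∣ (j : ℕ)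
      · rwa [vX, if_pos hd] at hv
      · rw [vX, if_neg hd] at hv
        obtain ⟨i, rfl⟩ : ∃ i, m = i + 1 := ⟨m - 1, by have := j.pos; omega⟩
        have hne : ((i : F) + 1) ≠ 0 := by
          intro h0
          apply hd
          rw [hj]
          exact ringChar.dvd (by push_cast; exact h0)
        have hji : j = Nat.succPNat i := PNat.eq (by rw [hj]; rfl)
        set R := (aeval (R := F) (vX F)).range
        rw [sN, hj, newton_succ, mul_add] at hv
        have hsum : (-1 : MvPolynomial ℕ+ F) ^ (i + 1) * ∑ l ∈ Finset.range i,
            (-1 : MvPolynomial ℕ+ F) ^ l * X (Nat.succPNat l) * newtonPoly F (i - l) ∈ R := by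
          refine R.mul_mem (R.pow_mem (R.neg_mem R.one_mem) _) (R.sum_mem fun l hl => ?_)
          have hl' := Finset.mem_range.mp hl
          refine R.mul_mem (R.mul_mem (R.pow_mem (R.neg_mem R.one_mem) _)
            (ih (l + 1) (by omega) _ rfl)) ?_
          apply newton_mem
          intro q hq
          exact ih q (by omega) q rfl
        have h3 := R.sub_mem hv hsum
        rw [add_sub_cancel_left] at h3
        have h4 : X j = C (-((i : F) + 1)⁻¹) * ((-1 : MvPolynomial ℕ+ F) ^ (i + 1) *
            ((-1) ^ i * ((i : MvPolynomial ℕ+ F) + 1) * X (Nat.succPNat i))) := by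
          have h5 : C (-((i : F) + 1)⁻¹) * ((i : MvPolynomial ℕ+ F) + 1) = -1 := by
            rw [show ((i : MvPolynomial ℕ+ F) + 1) = C ((i : F) + 1) by simp, ← C_mul, neg_mul,
              inv_mul_cancel₀ hne]
            simp
          have h6 : (-1 : MvPolynomial ℕ+ F) ^ (i + 1) * (-1) ^ i = -1 := by
            rw [← pow_add]
            exact Odd.neg_one_pow ⟨i, by ring⟩
          calc X j = (-1) * (-1) * X (Nat.succPNat i) := by rw [hji]; ring
            _ = (C (-((i : F) + 1)⁻¹) * ((i : MvPolynomial ℕ+ F) + 1)) *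
                ((-1 : MvPolynomial ℕ+ F) ^ (i + 1) * (-1) ^ i) * X (Nat.succPNat i) := by
              rw [h5, h6]
            _ = _ := by ring
        rw [h4]
        exact R.mul_mem (R.algebraMap_mem _) h3
  rw [← AlgHom.range_eq_top, eq_top_iff, ← adjoin_range_X, Algebra.adjoin_le_iff]
  rintro _ ⟨j, rfl⟩
  exact hX _ j rfl

theorem x_ideal (n : ℕ) (hn : 1 ≤ n) :
    Ideal.span (Set.range fun j : ℕ => newtonPoly F (n + j)) =
      Ideal.span {f | ∃ j, 0 < eF F n j ∧ sN F (j * eF F n j) = f} := by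
  have h1 : Ideal.span (Set.range fun j : ℕ => newtonPoly F (n + j)) =
      Ideal.span (Set.range fun j : ℕ => sN F (n + j)) := by
    apply le_antisymm <;> rw [Ideal.span_le] <;> rintro _ ⟨j, rfl⟩
    · have : newtonPoly F (n + j) = (-1) ^ (n + j) * sN F (n + j) := by
        rw [sN, ← mul_assoc, ← mul_pow]; simp
      change newtonPoly F (n + j) ∈ _
      rw [this]
      exact Ideal.mul_mem_left _ _ (Ideal.subset_span ⟨j, rfl⟩)
    · exact Ideal.mul_mem_left _ _ (Ideal.subset_span ⟨j, rfl⟩)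
  rw [h1]
  apply ideal_eq (ringChar F) n (char_cases F) hn (sN F)
  intro hp j hj
  haveI : Fact (ringChar F).Prime := ⟨hp⟩
  rw [sN_frob]
  have hlt : j < ringChar F * j := by have := hp.two_le; nlinarith
  have hm : sN F j ∈ Ideal.span {f | ∃ i, n ≤ i ∧ i < ringChar F * j ∧ sN F i = f} :=
    Ideal.subset_span ⟨j, hj, hlt, rfl⟩
  exact Ideal.pow_mem_of_mem _ hm _ hp.pos

theorem x_psi (n : ℕ) (y : MvPolynomial ℕ+ F) :
    Psi (eF F n) (vX F) (fun j => sN F (j * eF F n j)) y = aeval (vX F) y :=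
  Psi_aeval _ _ _ (fun j hj => sN_eq_pow F n j hj) y

theorem sN_hom' (n : ℕ) (j : ℕ+) :
    IsWeightedHomogeneous xWeight (sN F (j * eF F n j)) (eF F n j * xWeight j) := by
  have := sN_hom F (j * eF F n j)
  rwa [show 2 * ((j : ℕ) * eF F n j) = eF F n j * xWeight j by unfold xWeight; ring] at this

theorem x_rank (n : ℕ) (hn : 1 ≤ n) (d : ℕ) : Module.finrank F (pieceX F n d) =
    Nat.card {m : ℕ+ →₀ ℕ | Finsupp.weight xWeight m = d ∧ m ∈ Std (eF F n)} := by
  apply finrank_piece (eF F n) (vX F) (fun j => sN F (j * eF F n j)) xWeight xW_fin xW_pos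
    (vX_hom F)
  · exact fun j _ => sN_hom' F n j
  · intro f
    obtain ⟨y, hy⟩ := vX_surj F f
    exact ⟨y, by rw [x_psi, hy]⟩
  · exact x_ideal F n hn

end xcase

section acase
variable (F : Type) [Field F] (n : ℕ) (k : ℤ)

/-- Exponents for `A`. -/
noncomputable def eA : Fin n ⊕ ℕ+ → ℕ := Sum.elim (fun _ => 0) (eF F n)

/-- Coordinates for `A`. -/
noncomputable def vA : Fin n ⊕ ℕ+ → MvPolynomial (Fin n ⊕ ℕ+) F :=
  Sum.elim (fun i => X (Sum.inl i)) (fun j => rename Sum.inr (vX F j))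

/-- Basic relations for `A`. -/
noncomputable def gA : Fin n ⊕ ℕ+ → MvPolynomial (Fin n ⊕ ℕ+) F :=
  Sum.elim (fun _ => 0) (fun j => hRel F n k (j * eF F n j))

theorem rename_hom (f : MvPolynomial ℕ+ F) (d : ℕ) (hf : IsWeightedHomogeneous xWeight f d) :
    IsWeightedHomogeneous (cxWeight n) (rename Sum.inr f : MvPolynomial (Fin n ⊕ ℕ+) F) d := by
  intro m hm
  obtain ⟨u, rfl, hu⟩ := coeff_rename_ne_zero _ _ _ hm
  rw [weight_inr]
  exact hf hu

theorem cvar_hom (m : ℕ) : IsWeightedHomogeneous (cxWeight n) (cvar F n m) (2 * m) := by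
  unfold cvar
  split_ifs with h0 h
  · rw [h0]; exact isWeightedHomogeneous_one _ _
  · have := isWeightedHomogeneous_X F (cxWeight n) (Sum.inl ⟨m - 1, by omega⟩)
    have h2 : cxWeight n (Sum.inl ⟨m - 1, by omega⟩) = 2 * m := by
      change 2 * (m - 1 + 1) = 2 * m
      omega
    rwa [h2] at this
  · exact isWeightedHomogeneous_zero _ _ _

theorem hRel_hom (i : ℕ) : IsWeightedHomogeneous (cxWeight n) (hRel F n k i) (2 * i) := by
  unfold hRel
  apply IsWeightedHomogeneous.add
  · exact (cvar_hom F n i).C_mul _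
  · apply IsWeightedHomogeneous.sum
    intro j hj
    have hj' := Finset.mem_range.mp hj
    rw [show (-1 : MvPolynomial (Fin n ⊕ ℕ+) F) ^ (j + 1) = C ((-1) ^ (j + 1)) by simp]
    have := ((rename_hom F n _ _ (newton_hom F (j + 1))).C_mul ((-1) ^ (j + 1))).mul
      (cvar_hom F n (i - (j + 1)))
    rwa [show 2 * (j + 1) + 2 * (i - (j + 1)) = 2 * i by omega] at this

theorem vA_hom (j : Fin n ⊕ ℕ+) : IsWeightedHomogeneous (cxWeight n) (vA F n j) (cxWeight n j) := by
  rcases j with i | j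
  · exact isWeightedHomogeneous_X F (cxWeight n) (Sum.inl i)
  · exact rename_hom F n _ _ (vX_hom F j)

theorem gA_hom (j : Fin n ⊕ ℕ+) (hj : 0 < eA F n j) :
    IsWeightedHomogeneous (cxWeight n) (gA F n k j) (eA F n j * cxWeight n j) := by
  rcases j with i | j
  · simp [eA] at hj
  · have := hRel_hom F n k (j * eF F n j)
    rwa [show 2 * ((j : ℕ) * eF F n j) = eA F n (Sum.inr j) * cxWeight n (Sum.inr j) by
      simp [eA, cxWeight]; ring] at this

open Classical in
/-- Coefficients of the generating function. -/
noncomputable def TA (j : ℕ) : MvPolynomial (Fin n ⊕ ℕ+) F :=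
  if j = 0 then C (k : F) else (-1) ^ j * rename Sum.inr (newtonPoly F j)

theorem hRel_eq (i : ℕ) : hRel F n k i =
    ∑ x ∈ Finset.HasAntidiagonal.antidiagonal i, TA F n k x.1 * cvar F n x.2 := by
  rw [Finset.Nat.sum_antidiagonal_eq_sum_range_succ_mk, Finset.sum_range_succ', add_comm]
  simp [hRel, TA]

theorem TA_frob (p : ℕ) [hp : Fact p.Prime] [CharP F p] (a : ℕ) :
    TA F n k (p * a) = TA F n k a ^ p := by
  unfold TA
  by_cases ha : a = 0
  · subst ha
    rw [mul_zero, if_pos rfl, ← C_pow]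
    congr 1
    exact (map_intCast (frobenius F p) k).symm
  · rw [if_neg ha, if_neg (Nat.mul_ne_zero hp.out.ne_zero ha), newton_frob, map_pow, mul_pow,
      ← pow_mul, mul_comm a p]

theorem a_ideal (hn : 1 ≤ n) :
    Ideal.span (Set.range fun j : ℕ => hRel F n k (n + j)) =
      Ideal.span {f | ∃ j, 0 < eA F n j ∧ gA F n k j = f} := by
  rw [ideal_eq (ringChar F) n (char_cases F) hn (hRel F n k)]
  · congr 1
    ext f
    constructor
    · rintro ⟨j, hj, rfl⟩
      exact ⟨Sum.inr j, hj, rfl⟩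
    · rintro ⟨i | j, hj, rfl⟩
      · simp [eA] at hj
      · exact ⟨j, hj, rfl⟩
  · intro hp j hj
    haveI : Fact (ringChar F).Prime := ⟨hp⟩
    refine h_rec (ringChar F) n (TA F n k) (cvar F n) (hRel F n k) (TA_frob F n k (ringChar F))
      (by simp [cvar]) ?_ (hRel_eq F n k) j (by omega) hj
    intro m hm
    rw [cvar, dif_neg (by omega), dif_neg (by omega)]

/-- Killing the `c` variables. -/
noncomputable def piA : MvPolynomial (Fin n ⊕ ℕ+) F →ₐ[F] MvPolynomial ℕ+ F :=
  killCompl Sum.inr_injective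

theorem piA_rename (f : MvPolynomial ℕ+ F) : piA F n (rename Sum.inr f) = f :=
  killCompl_rename_app _ f

theorem piA_cvar (m : ℕ) : piA F n (cvar F n m) = if m = 0 then 1 else 0 := by
  unfold cvar
  split_ifs with h0 h
  · simp
  · simp [piA, killCompl]
  · simp

theorem piA_hRel (i : ℕ) (hi : 1 ≤ i) : piA F n (hRel F n k i) = sN F i := by
  obtain ⟨i, rfl⟩ : ∃ l, i = l + 1 := ⟨i - 1, by omega⟩
  unfold hRel
  rw [map_add, map_mul, piA_cvar, if_neg (by omega), mul_zero, zero_add, map_sum,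
    Finset.sum_range_succ, Finset.sum_eq_zero, zero_add, map_mul, piA_cvar, if_pos (by omega),
    map_mul, piA_rename, sN]
  · simp
  · intro j hj
    have := Finset.mem_range.mp hj
    rw [map_mul, piA_cvar, if_neg (by omega), mul_zero]

theorem piA_Psi (y : MvPolynomial ℕ+ F) :
    piA F n (Psi (eA F n) (vA F n) (gA F n k) (rename Sum.inr y)) = aeval (vX F) y := by
  rw [← x_psi F n]
  have : (piA F n).toLinearMap ∘ₗ Psi (eA F n) (vA F n) (gA F n k) ∘ₗ
      (rename Sum.inr : MvPolynomial ℕ+ F →ₐ[F] MvPolynomial (Fin n ⊕ ℕ+) F).toLinearMap =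
      Psi (eF F n) (vX F) (fun j => sN F (j * eF F n j)) := by
    apply (basisMonomials ℕ+ F).ext
    intro m
    simp only [coe_basisMonomials, LinearMap.comp_apply, AlgHom.toLinearMap_apply,
      rename_monomial, Psi_monomial]
    rw [Finsupp.prod_mapDomain_index_inj Sum.inr_injective, map_finsuppProd]
    apply Finsupp.prod_congr
    intro j _
    unfold fac
    rw [map_mul, map_pow, map_pow]
    change piA F n (hRel F n k (j * eF F n j)) ^ (m j / eF F n j) *
      piA F n (rename Sum.inr (vX F j)) ^ (m j % eF F n j) = _
    rw [piA_rename]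
    rcases Nat.eq_zero_or_pos (eF F n j) with h0 | h0
    · simp [h0]
    · rw [piA_hRel F n k _ (Nat.mul_pos j.pos h0)]
  exact LinearMap.congr_fun this y

theorem psiA_surj : Function.Surjective (Psi (eA F n) (vA F n) (gA F n k)) := by
  classical
  set R := LinearMap.range (Psi (eA F n) (vA F n) (gA F n k)) with hR
  have hmon : ∀ d : ℕ, ∀ m : (Fin n ⊕ ℕ+) →₀ ℕ, Finsupp.weight (cxWeight n) m = d →
      monomial m (1 : F) ∈ R := by
    intro d
    induction d using Nat.strong_induction_on with
    | _ d ih =>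
      have hc : ∀ m : (Fin n ⊕ ℕ+) →₀ ℕ, Finsupp.weight (cxWeight n) m = d →
          (∃ i, m (Sum.inl i) ≠ 0) → monomial m (1 : F) ∈ R := by
        rintro m hm ⟨i, hi⟩
        obtain ⟨m', rfl⟩ : ∃ m', m = Finsupp.single (Sum.inl i) 1 + m' :=
          ⟨m - Finsupp.single (Sum.inl i) 1, (add_tsub_cancel_of_le (by
            rw [Finsupp.single_le_iff]; omega)).symm⟩
        rw [map_add, Finsupp.weight_single, one_smul] at hm
        have hpos := cxW_pos n (Sum.inl i)
        obtain ⟨y, hy⟩ := ih _ (by omega) m' rfl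
        refine ⟨X (Sum.inl i) * y, ?_⟩
        rw [Psi_v (eA F n) (vA F n) (gA F n k) (Sum.inl i) rfl, hy]
        change X (Sum.inl i) * monomial m' 1 = _
        rw [X, monomial_mul, one_mul]
      intro m hm
      by_cases hx : ∃ i, m (Sum.inl i) ≠ 0
      · exact hc m hm hx
      push Not at hx
      obtain ⟨m', rfl⟩ := exists_mapDomain n m hx
      rw [weight_inr] at hm
      obtain ⟨y0, hy0⟩ := vX_surj F (monomial m' 1)
      obtain ⟨y, hyh, hy⟩ : ∃ y, IsWeightedHomogeneous xWeight y d ∧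
          aeval (vX F) y = monomial m' (1 : F) := by
        refine ⟨weightedHomogeneousComponent xWeight d y0,
          weightedHomogeneousComponent_isWeightedHomogeneous d y0, ?_⟩
        rw [← x_psi F n, Psi_comp _ _ _ xWeight (vX_hom F) (fun j _ => sN_hom' F n j), x_psi, hy0,
          weightedHomogeneousComponent_of_mem (isWeightedHomogeneous_monomial xWeight m' 1 hm),
          if_pos rfl]
      set P := Psi (eA F n) (vA F n) (gA F n k) (rename Sum.inr y) with hP
      have hPh : IsWeightedHomogeneous (cxWeight n) P d := by
        have h1 := Psi_comp (eA F n) (vA F n) (gA F n k) (cxWeight n) (vA_hom F n) (gA_hom F n k) d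
          (rename Sum.inr y)
        rw [weightedHomogeneousComponent_of_mem (rename_hom F n y d hyh), if_pos rfl] at h1
        rw [hP, h1]
        exact weightedHomogeneousComponent_isWeightedHomogeneous d _
      have hmh : IsWeightedHomogeneous (cxWeight n)
          (monomial (m'.mapDomain Sum.inr) (1 : F)) d :=
        isWeightedHomogeneous_monomial _ _ _ (by rw [weight_inr, hm])
      have hDh : IsWeightedHomogeneous (cxWeight n)
          (P - monomial (m'.mapDomain Sum.inr) (1 : F)) d :=
        (weightedHomogeneousSubmodule F (cxWeight n) d).sub_mem hPh hmh
      have hpi : piA F n (P - monomial (m'.mapDomain Sum.inr) (1 : F)) = 0 := by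
        rw [map_sub, hP, piA_Psi, hy, ← rename_monomial, piA_rename, sub_self]
      have hD : P - monomial (m'.mapDomain Sum.inr) (1 : F) ∈ R := by
        generalize P - monomial (m'.mapDomain Sum.inr) (1 : F) = D at hDh hpi
        rw [D.as_sum]
        refine R.sum_mem fun u hu => ?_
        rw [mem_support_iff] at hu
        have : monomial u (coeff u D) = coeff u D • monomial u (1 : F) := by
          rw [smul_monomial, smul_eq_mul, mul_one]
        rw [this]
        refine R.smul_mem _ (hc u (hDh hu) ?_)
        by_contra hcon
        push Not at hcon
        obtain ⟨u', rfl⟩ := exists_mapDomain n u hcon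
        apply hu
        have h2 := congrArg (coeff u') hpi
        rwa [piA, coeff_killCompl, coeff_zero] at h2
      have := R.sub_mem (LinearMap.mem_range_self _ (rename Sum.inr y)) hD
      rwa [← hP, sub_sub_cancel] at this
  intro f
  change f ∈ R
  rw [f.as_sum]
  refine R.sum_mem fun u _ => ?_
  have : monomial u (coeff u f) = coeff u f • monomial u (1 : F) := by
    rw [smul_monomial, smul_eq_mul, mul_one]
  rw [this]
  exact R.smul_mem _ (hmon _ u rfl)

theorem A_rank (hn : 1 ≤ n) (d : ℕ) : Module.finrank F (pieceA F n k d) =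
    Nat.card {m : (Fin n ⊕ ℕ+) →₀ ℕ | Finsupp.weight (cxWeight n) m = d ∧
      m ∈ Std (Sum.elim (fun _ => 0) (eF F n))} :=
  finrank_piece (eA F n) (vA F n) (gA F n k) (cxWeight n) (cxW_fin n) (cxW_pos n)
    (vA_hom F n) (gA_hom F n k) (psiA_surj F n k) _ (a_ideal F n k hn) d

end acase

end PS

/-- `P_t(A) = P_t(F[x_1, x_2, …]/(s_n, s_{n+1}, …)) / ∏_{i=1}^n (1 - t^{2i})`. -/
theorem poincare_series_A (n : ℕ) (hn : 1 ≤ n) (k : ℤ) (F : Type) [Field F] :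
    (PowerSeries.mk fun d => (Module.finrank F (pieceA F n k d) : ℤ)) *
        ∏ i ∈ Finset.range n, (1 - (PowerSeries.X : PowerSeries ℤ) ^ (2 * (i + 1)))
      = PowerSeries.mk fun d => (Module.finrank F (pieceX F n d) : ℤ) := by
  simp only [PS.A_rank F n k hn, PS.x_rank F n hn]
  exact PS.count_all n (PS.eF F n)
end
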